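/- arXiv:math/0305432 — 4 statements merged into one kernel-verified Lean document; each statement's English description precedes it below -/
import Mathlib

section
/- Let R be a Noetherian integrally closed (normal) domain and let φ : R^g → R^f be an injective R-linear map of finite free R-modules (so g ≤ f). Let I_g(φ) ⊆ R be the ideal generated by the g × g minors of a matrix representing φ. Then the cokernel E = R^f / φ(R^g) is a torsion-free R-module if and only if every prime ideal of R containing I_g(φ) has height at least 2 (equivalently, I_g(φ) is contained in no height-one prime of R). -/
/-- The ideal generated by the `g × g` minors of the `f × g` matrix `A`
(the matrix of a linear map `R^g → R^f`). -/
def maximalMinorsIdeal {R : Type*} [CommRing R] {f g : ℕ}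
    (A : Matrix (Fin f) (Fin g) R) : Ideal R :=
  Ideal.span {x : R | ∃ rows : Fin g → Fin f, Function.Injective rows ∧
    x = (A.submatrix rows id).det}

/-- A matrix over a domain with trivial kernel has a nonzero maximal minor. -/
theorem Matrix.exists_submatrix_det_ne_zero {D : Type*} [CommRing D] [IsDomain D]
    {m n : Type*} [Fintype m] [Fintype n] [DecidableEq n] (B : Matrix m n D)
    (hB : Function.Injective B.mulVec) :
    ∃ rows : n → m, Function.Injective rows ∧ (B.submatrix rows id).det ≠ 0 := by
  let K := FractionRing D
  let C : Matrix m n K := B.map (algebraMap D K)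
  have hcols : LinearIndependent K C.col := by
    refine LinearIndependent.iff_fractionRing (R := D) (K := K) |>.mp ?_
    have h := (Matrix.mulVec_injective_iff.mp hB).map_injOn
      ((Algebra.linearMap D K).compLeft m)
      (fun v _ w _ h => funext fun i => IsFractionRing.injective D K (congrFun h i))
    exact h
  have hrank : C.rank = Fintype.card n := by
    rw [← Matrix.rank_transpose]
    exact LinearIndependent.rank_matrix (M := C.transpose) hcols
  obtain ⟨κ, a, ha, hspan, hli⟩ := exists_linearIndependent' K C.row
  have : Fintype κ := Fintype.ofInjective a ha
  have hcard : Fintype.card n = Fintype.card κ := by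
    rw [← hrank, Matrix.rank_eq_finrank_span_row, ← hspan, finrank_span_eq_card hli]
  let e : n ≃ κ := Fintype.equivOfCardEq hcard
  refine ⟨a ∘ e, ha.comp e.injective, fun h => ?_⟩
  have hli' : LinearIndependent K (C.submatrix (a ∘ e) id).row := hli.comp e e.injective
  have hu := (Matrix.isUnit_iff_isUnit_det _).mp (Matrix.linearIndependent_rows_iff_isUnit.mp hli')
  refine hu.ne_zero ?_
  have hmap : C.submatrix (a ∘ e) id = (algebraMap D K).mapMatrix (B.submatrix (a ∘ e) id) := rfl
  rw [hmap, ← RingHom.map_det, h, map_zero]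

/-- If all maximal minors of `A` lie in a prime `p`, then `A` has a nontrivial kernel modulo `p`. -/
theorem exists_mulVec_mem_of_maximalMinorsIdeal_le {R : Type*} [CommRing R] {f g : ℕ}
    (A : Matrix (Fin f) (Fin g) R) (p : Ideal R) [p.IsPrime] (hA : maximalMinorsIdeal A ≤ p) :
    ∃ u : Fin g → R, (∃ j, u j ∉ p) ∧ ∀ i, A.mulVec u i ∈ p := by
  let π := Ideal.Quotient.mk p
  have hker : ¬ Function.Injective (A.map π).mulVec := fun h => by
    obtain ⟨rows, hrows, hdet⟩ := Matrix.exists_submatrix_det_ne_zero _ h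
    refine hdet ?_
    have hmap : (A.map π).submatrix rows id = π.mapMatrix (A.submatrix rows id) := rfl
    rw [hmap, ← RingHom.map_det, Ideal.Quotient.eq_zero_iff_mem]
    exact hA (Ideal.subset_span ⟨rows, hrows, rfl⟩)
  simp only [Function.Injective, not_forall] at hker
  obtain ⟨v, w, hvw, hne⟩ := hker
  obtain ⟨j, hj⟩ := Function.ne_iff.mp hne
  obtain ⟨v, rfl⟩ := Ideal.Quotient.mk_surjective.comp_left v
  obtain ⟨w, rfl⟩ := Ideal.Quotient.mk_surjective.comp_left w
  refine ⟨v - w, ⟨j, fun h => hj ?_⟩, fun i => ?_⟩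
  · exact Ideal.Quotient.eq.mpr h
  · rw [← Ideal.Quotient.eq_zero_iff_mem, Matrix.mulVec_sub, Pi.sub_apply, map_sub,
      RingHom.map_mulVec, RingHom.map_mulVec, sub_eq_zero]
    exact congrFun hvw i

section NormalDomain

variable {R : Type*} [CommRing R] [IsDomain R] [IsNoetherianRing R] [IsIntegrallyClosed R]

/-- A prime of the form `(a : y)` in a Noetherian normal domain becomes principal after
localization at itself. -/
theorem exists_local_generator_of_colon {p : Ideal R} [p.IsPrime] {a y : R} (ha : a ≠ 0)
    (hp : ∀ q, q ∈ p ↔ a ∣ q * y) :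
    ∃ x ∈ p, x ≠ 0 ∧ ∃ s ∉ p, ∀ q ∈ p, x ∣ s * q := by
  have hap : a ∈ p := (hp a).mpr (dvd_mul_right a y)
  obtain ⟨x, hx, s, hxs, hs⟩ : ∃ x ∈ p, ∃ s, x * y = a * s ∧ s ∉ p := by
    by_contra! H
    have haK : algebraMap R (FractionRing R) a ≠ 0 := by simpa using ha
    let N : Submodule R (FractionRing R) := Submodule.map (Algebra.linearMap R (FractionRing R)) p
    have hint : IsIntegral R (algebraMap R (FractionRing R) y / algebraMap R (FractionRing R) a) := by
      refine isIntegral_of_smul_mem_submodule N ?_ ((IsNoetherian.noetherian p).map _) _ ?_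
      · refine fun h => haK ?_
        have hmem : algebraMap R (FractionRing R) a ∈ N := ⟨a, hap, rfl⟩
        simpa [h] using hmem
      · rintro _ ⟨q, hq, rfl⟩
        obtain ⟨t, ht⟩ := (hp q).mp hq
        refine ⟨t, H q hq t ht, ?_⟩
        have := congrArg (algebraMap R (FractionRing R)) ht
        simp only [map_mul] at this
        simp only [Algebra.linearMap_apply, smul_eq_mul]
        field_simp
        linear_combination -this
    obtain ⟨c, hc⟩ := IsIntegrallyClosed.isIntegral_iff.mp hint
    refine Ideal.IsPrime.ne_top ‹_› ((Ideal.eq_top_iff_one p).mpr ((hp 1).mpr ⟨c, ?_⟩))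
    apply IsFractionRing.injective R (FractionRing R)
    rw [one_mul, map_mul, hc, mul_div_cancel₀ _ haK]
  refine ⟨x, hx, ?_, s, hs, fun q hq => ?_⟩
  · rintro rfl
    have : s = 0 := by simpa [ha] using hxs.symm
    exact hs (this ▸ p.zero_mem)
  · obtain ⟨t, ht⟩ := (hp q).mp hq
    exact ⟨t, mul_left_cancel₀ ha (by linear_combination x * ht - q * hxs)⟩

/-- Associated primes of a nonzero principal ideal in a Noetherian normal domain have height at
most one. -/
theorem height_le_one_of_colon {p : Ideal R} [p.IsPrime] {a y : R} (ha : a ≠ 0)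
    (hp : ∀ q, q ∈ p ↔ a ∣ q * y) : p.height ≤ 1 := by
  obtain ⟨x, hx, -, s, hs, hdvd⟩ := exists_local_generator_of_colon ha hp
  refine Ideal.height_le_one_of_isPrincipal_of_mem_minimalPrimes (Ideal.span {x}) p
    ⟨⟨‹_›, (Ideal.span_singleton_le_iff_mem p).mpr hx⟩, fun q' hq' hle q hq => ?_⟩
  have := hq'.1
  refine (this.mem_or_mem (q'.mem_of_dvd (hdvd q hq) ?_)).resolve_left fun h => hs (hle h)
  exact hq'.2 (Ideal.mem_span_singleton_self x)

theorem mem_colon_bot_mk_iff {R : Type*} [CommRing R] (a y q : R) :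
    q ∈ (⊥ : Submodule R (R ⧸ Ideal.span {a})).colon {Ideal.Quotient.mk (Ideal.span {a}) y} ↔
      a ∣ q * y := by
  rw [Submodule.mem_colon_singleton, Submodule.mem_bot, ← Ideal.mem_span_singleton,
    ← Ideal.Quotient.eq_zero_iff_mem, map_mul]
  rfl

/-- If no prime of height at most one contains `I`, then nonzero principal ideals are saturated
with respect to `I`. -/
theorem dvd_of_forall_mem_dvd_mul {I : Ideal R}
    (hI : ∀ (p : Ideal R) [p.IsPrime], I ≤ p → 2 ≤ p.height) {a y : R} (ha : a ≠ 0)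
    (h : ∀ d ∈ I, a ∣ d * y) : a ∣ y := by
  by_contra hy
  have hy' : Ideal.Quotient.mk (Ideal.span {a}) y ≠ 0 := by
    rwa [Ne, Ideal.Quotient.eq_zero_iff_mem, Ideal.mem_span_singleton]
  obtain ⟨p, hp, hle⟩ := exists_le_isAssociatedPrime_of_isNoetherianRing R _ hy'
  obtain ⟨hprime, z, hz⟩ := isAssociatedPrime_iff.mp hp
  obtain ⟨z, rfl⟩ := Ideal.Quotient.mk_surjective z
  have h1 : p.height ≤ 1 :=
    height_le_one_of_colon ha fun q => by rw [hz, mem_colon_bot_mk_iff]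
  have h2 : 2 ≤ p.height := hI p fun d hd => hle ((mem_colon_bot_mk_iff a y d).mpr (h d hd))
  exact absurd (h2.trans h1) (by decide)

/-- In a Noetherian normal domain, a nonzero prime of height less than two becomes principal after
localization at itself. -/
theorem exists_local_generator_of_height_lt_two {p : Ideal R} [hp : p.IsPrime] (hp0 : p ≠ ⊥)
    (hht : Order.height (⟨p, hp⟩ : PrimeSpectrum R) < 2) :
    ∃ x ∈ p, x ≠ 0 ∧ ∃ s ∉ p, ∀ q ∈ p, x ∣ s * q := by
  obtain ⟨a, hap, ha⟩ := p.ne_bot_iff.mp hp0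
  have hmin : p ∈ (Ideal.span {a}).minimalPrimes := by
    refine ⟨⟨hp, (Ideal.span_singleton_le_iff_mem p).mpr hap⟩, fun q hq hle => ?_⟩
    by_contra hlt
    have haq : a ∈ q := hq.2 (Ideal.mem_span_singleton_self a)
    have h1 : (⟨⊥, Ideal.isPrime_bot⟩ : PrimeSpectrum R) < ⟨q, hq.1⟩ :=
      show (⊥ : Ideal R) < q from bot_lt_iff_ne_bot.mpr (q.ne_bot_iff.mpr ⟨a, haq, ha⟩)
    have h2 : (⟨q, hq.1⟩ : PrimeSpectrum R) < ⟨p, hp⟩ := lt_of_le_not_ge hle hlt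
    have h3 := Order.height_add_one_le h1
    have h4 := Order.height_add_one_le h2
    refine absurd hht (not_lt.mpr (le_trans ?_ h4))
    calc (2 : ℕ∞) = 1 + 1 := by norm_num
      _ ≤ _ := by gcongr; exact le_trans le_add_self h3
  rw [← Ideal.annihilator_quotient (I := Ideal.span {a})] at hmin
  obtain ⟨-, z, hz⟩ := isAssociatedPrime_iff.mp
    (Module.associatedPrimes.minimalPrimes_annihilator_subset_associatedPrimes R _ hmin)
  obtain ⟨y, rfl⟩ := Ideal.Quotient.mk_surjective z
  exact exists_local_generator_of_colon ha fun q => by rw [hz, mem_colon_bot_mk_iff]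

end NormalDomain

/-- Let `R` be a Noetherian integrally closed domain and `φ : R^g → R^f` an injective
`R`-linear map (given by the matrix `A`).  Then the cokernel `E = R^f / φ(R^g)` is
torsion-free if and only if every prime ideal of `R` containing the ideal `I_g(φ)` of
`g × g` minors of `A` has height at least `2`. -/
theorem cokernel_torsionFree_iff_minors_height_ge_two
    {R : Type*} [CommRing R] [IsDomain R] [IsNoetherianRing R] [IsIntegrallyClosed R]
    {f g : ℕ} (A : Matrix (Fin f) (Fin g) R)
    (hinj : Function.Injective A.mulVecLin) :
    NoZeroSMulDivisors R ((Fin f → R) ⧸ LinearMap.range A.mulVecLin) ↔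
      ∀ (p : Ideal R) (hp : p.IsPrime), maximalMinorsIdeal A ≤ p →
        2 ≤ Order.height (⟨p, hp⟩ : PrimeSpectrum R) := by
  constructor
  · intro htf p hp hle
    by_contra! hht
    obtain ⟨u, ⟨j, hj⟩, hu⟩ := exists_mulVec_mem_of_maximalMinorsIdeal_le A p hle
    rcases eq_or_ne p ⊥ with rfl | hp0
    · have : u = 0 := hinj (by ext i; simpa using hu i)
      simp [this] at hj
    obtain ⟨x, hx, hx0, s, hs, hdvd⟩ := exists_local_generator_of_height_lt_two hp0 hht
    choose v hv using fun i => hdvd _ (hu i)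
    have hsv : A.mulVecLin (s • u) = x • v := by
      ext i
      simpa [Matrix.mulVec_smul] using hv i
    have hzero : x • (Submodule.Quotient.mk v : _ ⧸ LinearMap.range A.mulVecLin) = 0 := by
      rw [← Submodule.Quotient.mk_smul, Submodule.Quotient.mk_eq_zero]
      exact ⟨_, hsv⟩
    obtain ⟨w, hw⟩ := (Submodule.Quotient.mk_eq_zero _).mp
      ((htf.eq_zero_or_eq_zero_of_smul_eq_zero hzero).resolve_left hx0)
    have hsu : s • u = x • w := hinj (by rw [hsv, map_smul, hw])
    have hmem : s * u j ∈ p := by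
      have := congrFun hsu j
      simp only [Pi.smul_apply, smul_eq_mul] at this
      exact this ▸ p.mul_mem_right _ hx
    exact (hp.mem_or_mem hmem).elim hs hj
  · refine fun hht => ⟨fun {r z} hrz => or_iff_not_imp_left.mpr fun hr => ?_⟩
    obtain ⟨v, rfl⟩ := Submodule.Quotient.mk_surjective _ z
    rw [← Submodule.Quotient.mk_smul, Submodule.Quotient.mk_eq_zero] at hrz
    obtain ⟨u, hu⟩ := hrz
    have hminor : ∀ j, ∀ d ∈ maximalMinorsIdeal A, r ∣ d * u j := by
      intro j d hd
      induction hd using Submodule.span_induction with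
      | mem d hd =>
        obtain ⟨rows, -, rfl⟩ := hd
        have h : (A.submatrix rows id).mulVec u = r • (v ∘ rows) :=
          funext fun i => congrFun hu (rows i)
        have h' := congrArg (fun t => (A.submatrix rows id).adjugate.mulVec t j) h
        simp only [Matrix.mulVec_mulVec, Matrix.adjugate_mul, Matrix.smul_mulVec,
          Matrix.one_mulVec, Matrix.mulVec_smul, Pi.smul_apply, smul_eq_mul] at h'
        exact ⟨_, h'⟩
      | zero => simp
      | add d e _ _ hd he => rw [add_mul]; exact dvd_add hd he
      | smul c d _ hd => rw [smul_eq_mul, mul_assoc]; exact hd.mul_left c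
    choose w hw using fun j => dvd_of_forall_mem_dvd_mul
      (fun p hp hle => (hht p hp hle).trans_eq (PrimeSpectrum.height_eq_orderHeight ⟨p, hp⟩).symm)
      hr (hminor j)
    refine (Submodule.Quotient.mk_eq_zero _).mpr ⟨w, smul_right_injective _ hr ?_⟩
    have huw : u = r • w := funext hw
    simpa only [huw, map_smul] using hu
end

section
/- Suppose 1 ≤ a ≤ f − g. Then the ideal I generated by the ag entries of the product XY of the generic a × f matrix X with the generic f × g matrix Y is a prime ideal of height ag in the polynomial ring R, and the quotient ring R/I is an integral domain of Krull dimension fg + a(f − g). -/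
open MvPolynomial

/-- The `(i,j)` entry of the product `X·Y` of the generic `a × f` matrix `X` and the
generic `f × g` matrix `Y`, as an element of the polynomial ring
`k[x_{il}, y_{lj}]` in `af + fg` variables. -/
noncomputable def genericProdEntry (k : Type*) [CommSemiring k] (a f g : ℕ)
    (i : Fin a) (j : Fin g) : MvPolynomial ((Fin a × Fin f) ⊕ (Fin f × Fin g)) k :=
  ∑ l : Fin f, X (Sum.inl (i, l)) * X (Sum.inr (l, j))

/-- The ideal generated by the `a·g` entries of the generic matrix product `X·Y`. -/
noncomputable def genericComplexIdeal (k : Type*) [CommSemiring k] (a f g : ℕ) :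
    Ideal (MvPolynomial ((Fin a × Fin f) ⊕ (Fin f × Fin g)) k) :=
  Ideal.span {P | ∃ i : Fin a, ∃ j : Fin g, P = genericProdEntry k a f g i j}

section LeadingExponents

variable {σ k : Type*} [CommRing k]

/-- `HasLeadingExponent w P d` says that `P` is the sum of the monomial with exponent `d`
and of terms whose `w`-weight is smaller than the weight of `d`. -/
def HasLeadingExponent (w : σ → ℕ) (P : MvPolynomial σ k) (d : σ →₀ ℕ) : Prop :=
  P - monomial d 1 ∈ restrictSupport k {e | Finsupp.weight w e < Finsupp.weight w d}

variable {w : σ → ℕ}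

theorem hasLeadingExponent_monomial (d : σ →₀ ℕ) :
    HasLeadingExponent w (monomial d (1 : k)) d := by
  simp [HasLeadingExponent]

theorem mul_mem_restrictSupport_of_weight {P Q : MvPolynomial σ k} {s t u : Set (σ →₀ ℕ)}
    (hP : P ∈ restrictSupport k s) (hQ : Q ∈ restrictSupport k t)
    (h : ∀ x ∈ s, ∀ y ∈ t, x + y ∈ u) : P * Q ∈ restrictSupport k u := by
  classical
  intro e he
  obtain ⟨x, hx, y, hy, rfl⟩ := Finset.mem_add.1 (support_mul P Q he)
  exact h x (hP hx) y (hQ hy)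

theorem HasLeadingExponent.mul {P Q : MvPolynomial σ k} {d e : σ →₀ ℕ}
    (hP : HasLeadingExponent w P d) (hQ : HasLeadingExponent w Q e) :
    HasLeadingExponent w (P * Q) (d + e) := by
  have h : P * Q - monomial (d + e) 1 = (P - monomial d 1) * (Q - monomial e 1) +
      (P - monomial d 1) * monomial e 1 + monomial d 1 * (Q - monomial e 1) := by
    have : monomial (d + e) (1 : k) = monomial d 1 * monomial e 1 := by simp
    rw [this]; ring
  have hd : monomial d (1 : k) ∈ restrictSupport k {d} := by simp
  have he : monomial e (1 : k) ∈ restrictSupport k {e} := by simp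
  rw [HasLeadingExponent, h]
  refine add_mem (add_mem ?_ ?_) ?_
  · refine mul_mem_restrictSupport_of_weight hP hQ fun x hx y hy => ?_
    simp only [Set.mem_ofPred_eq, map_add] at *
    omega
  · refine mul_mem_restrictSupport_of_weight hP he fun x hx y hy => ?_
    simp only [Set.mem_ofPred_eq, map_add, Set.mem_singleton_iff] at *
    subst hy; omega
  · refine mul_mem_restrictSupport_of_weight hd hQ fun x hx y hy => ?_
    simp only [Set.mem_ofPred_eq, map_add, Set.mem_singleton_iff] at *
    subst hx; omega

theorem HasLeadingExponent.pow {P : MvPolynomial σ k} {d : σ →₀ ℕ}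
    (hP : HasLeadingExponent w P d) (n : ℕ) : HasLeadingExponent w (P ^ n) (n • d) := by
  induction n with
  | zero => simpa using hasLeadingExponent_monomial (k := k) (w := w) 0
  | succ n ih => rw [pow_succ, succ_nsmul]; exact ih.mul hP

theorem HasLeadingExponent.prod {ι : Type*} (s : Finset ι) {P : ι → MvPolynomial σ k}
    {d : ι → σ →₀ ℕ} (hP : ∀ i ∈ s, HasLeadingExponent w (P i) (d i)) :
    HasLeadingExponent w (∏ i ∈ s, P i) (∑ i ∈ s, d i) := by
  classical
  induction s using Finset.induction_on with
  | empty => simpa using hasLeadingExponent_monomial (k := k) (w := w) 0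
  | insert a s ha ih =>
    rw [Finset.prod_insert ha, Finset.sum_insert ha]
    exact (hP a (by simp)).mul (ih fun i hi => hP i (by simp [hi]))

theorem hasLeadingExponent_sum {ι : Type*} [Fintype ι] (c : ι → k) (e : ι → σ →₀ ℕ) (i : ι)
    (hc : c i = 1) (h : ∀ j, j ≠ i → Finsupp.weight w (e j) < Finsupp.weight w (e i)) :
    HasLeadingExponent w (∑ j, monomial (e j) (c j)) (e i) := by
  classical
  rw [HasLeadingExponent, ← Finset.add_sum_erase _ _ (Finset.mem_univ i), hc, add_sub_cancel_left]
  refine sum_mem fun j hj => ?_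
  rw [monomial_mem_restrictSupport]
  exact Or.inl (h j (Finset.ne_of_mem_erase hj))

/-- Polynomials whose leading exponents enumerate all exponents are linearly independent. -/
theorem linearIndependent_of_hasLeadingExponent {B : Type*} {b : B → MvPolynomial σ k}
    {e : B → σ →₀ ℕ} (hb : ∀ x, HasLeadingExponent w (b x) (e x)) (he : Function.Injective e) :
    LinearIndependent k b := by
  classical
  rw [linearIndependent_iff']
  intro s c hc
  by_contra! hne
  obtain ⟨i, hi, hci⟩ := hne
  obtain ⟨m, hm, hmax⟩ := Finset.exists_max_image (s.filter fun x => c x ≠ 0)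
    (fun x => Finsupp.weight w (e x)) ⟨i, by simp [hi, hci]⟩
  rw [Finset.mem_filter] at hm
  have hcoeff : ∀ x ∈ s, x ≠ m → c x * coeff (e m) (b x) = 0 := by
    intro x hx hxm
    by_cases hcx : c x = 0
    · simp [hcx]
    have hle := hmax x (by simp [hx, hcx])
    have h1 : coeff (e m) (b x - monomial (e x) 1) = 0 := by
      by_contra h
      have := hb x (mem_support_iff.2 h)
      simp only [Set.mem_ofPred_eq] at this
      omega
    rw [coeff_sub, coeff_monomial, if_neg (fun h => hxm (he h)), sub_zero] at h1
    simp [h1]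
  have h2 : coeff (e m) (b m) = 1 := by
    have h1 : coeff (e m) (b m - monomial (e m) 1) = 0 := by
      by_contra h
      have := hb m (mem_support_iff.2 h)
      simp at this
    rw [coeff_sub, coeff_monomial, if_pos rfl, sub_eq_zero] at h1
    exact h1
  have h3 := congrArg (coeff (e m)) hc
  rw [coeff_sum, coeff_zero, Finset.sum_eq_single_of_mem m hm.1 (by simpa using hcoeff)] at h3
  simp only [coeff_smul, h2, smul_eq_mul, mul_one] at h3
  exact hm.2 h3

theorem span_eq_top_of_hasLeadingExponent {B : Type*} {b : B → MvPolynomial σ k}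
    {e : B → σ →₀ ℕ} (hb : ∀ x, HasLeadingExponent w (b x) (e x)) (he : Function.Surjective e) :
    ⊤ ≤ Submodule.span k (Set.range b) := by
  have key : ∀ n : ℕ, ∀ d : σ →₀ ℕ, Finsupp.weight w d < n →
      monomial d (1 : k) ∈ Submodule.span k (Set.range b) := by
    intro n
    induction n with
    | zero => intro d hd; omega
    | succ n ih =>
      intro d hd
      obtain ⟨x, rfl⟩ := he d
      have h1 : b x - monomial (e x) 1 ∈ Submodule.span k (Set.range b) := by
        have h2 := hb x
        rw [HasLeadingExponent, restrictSupport_eq_span] at h2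
        refine Submodule.span_le.2 ?_ h2
        rintro _ ⟨d', hd', rfl⟩
        refine ih d' ?_
        simp only [Set.mem_ofPred_eq] at hd'
        omega
      have := sub_mem (Submodule.subset_span (Set.mem_range_self x)) h1
      rwa [sub_sub_cancel] at this
  intro p _
  rw [p.as_sum]
  refine sum_mem fun d _ => ?_
  have : monomial d (coeff d p) = coeff d p • monomial d (1 : k) := by simp [smul_monomial]
  rw [this]
  exact Submodule.smul_mem _ _ (key _ d (Nat.lt_succ_self _))

variable {ι : Type*}

/-- Pairs of an exponent vector on `ι` and a monomial exponent divisible by none of the `d i`. -/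
abbrev ReducedExponent (d : ι → σ →₀ ℕ) : Type _ :=
  (ι → ℕ) × {m : σ →₀ ℕ // ∀ i, ¬ d i ≤ m}

/-- The sum `∑ i, α i • d i + m` attached to a pair `(α, m)`. -/
noncomputable def ReducedExponent.total [Fintype ι] {d : ι → σ →₀ ℕ} (x : ReducedExponent d) :
    σ →₀ ℕ :=
  ∑ i, x.1 i • d i + x.2.1

theorem ReducedExponent.total_injective [Fintype ι] {d : ι → σ →₀ ℕ}
    (hd : Pairwise fun i j => Disjoint (d i).support (d j).support) :
    Function.Injective (ReducedExponent.total (d := d)) := by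
  classical
  have key : ∀ (x : ReducedExponent d) (i : ι) (v : σ), v ∈ (d i).support →
      x.total v = x.1 i * d i v + x.2.1 v := by
    intro x i v hv
    rw [ReducedExponent.total, Finsupp.add_apply, Finsupp.finsetSum_apply,
      Finset.sum_eq_single_of_mem i (Finset.mem_univ i)]
    · simp
    · intro j _ hj
      have : d j v = 0 := Finsupp.notMem_support_iff.1
        (Finset.disjoint_left.1 (hd hj.symm) hv)
      simp [this]
  have hle : ∀ x y : ReducedExponent d, x.total = y.total → ∀ i, x.1 i ≤ y.1 i := by
    intro x y h i
    by_contra! hlt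
    refine y.2.2 i fun v => ?_
    by_cases hv : v ∈ (d i).support
    · have h1 := key x i v hv
      have h2 := key y i v hv
      rw [h] at h1
      have h3 : (y.1 i + 1) * d i v ≤ x.1 i * d i v := Nat.mul_le_mul_right _ hlt
      rw [add_mul, one_mul] at h3
      omega
    · simp [Finsupp.notMem_support_iff.1 hv]
  intro x y h
  have h1 : x.1 = y.1 := funext fun i => le_antisymm (hle x y h i) (hle y x h.symm i)
  refine Prod.ext h1 (Subtype.ext ?_)
  rw [ReducedExponent.total, ReducedExponent.total, h1] at h
  exact add_left_cancel h

theorem ReducedExponent.total_surjective [Fintype ι] {d : ι → σ →₀ ℕ} (hd : ∀ i, d i ≠ 0) :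
    Function.Surjective (ReducedExponent.total (d := d)) := by
  classical
  suffices h : ∀ (n : ℕ) (u : σ →₀ ℕ), u.degree < n → ∃ x : ReducedExponent d, x.total = u from
    fun u => h _ u (Nat.lt_succ_self _)
  intro n
  induction n with
  | zero => intro u hu; omega
  | succ n ih =>
    intro u hu
    by_cases h : ∃ i, d i ≤ u
    · obtain ⟨i, hi⟩ := h
      obtain ⟨u', rfl⟩ := exists_add_of_le hi
      have hpos : (d i).degree ≠ 0 := by
        rw [Ne, Finsupp.degree_eq_zero_iff]; exact hd i
      obtain ⟨x, rfl⟩ := ih u' (by rw [map_add] at hu; omega)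
      refine ⟨(x.1 + Pi.single i 1, x.2), ?_⟩
      simp [ReducedExponent.total, add_smul, Finset.sum_add_distrib, Pi.single_apply, ite_smul]
      abel
    · push Not at h
      exact ⟨(0, ⟨u, h⟩), by simp [ReducedExponent.total]⟩

/-- The product of the powers `P i ^ α i` and the monomial `m` attached to a pair `(α, m)`. -/
noncomputable def ReducedExponent.poly [Fintype ι] (P : ι → MvPolynomial σ k) {d : ι → σ →₀ ℕ}
    (x : ReducedExponent d) : MvPolynomial σ k :=
  (∏ i, P i ^ x.1 i) * monomial x.2.1 1

/-- Increase the `i`-th component of the exponent vector by one. -/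
def ReducedExponent.shift [DecidableEq ι] {d : ι → σ →₀ ℕ} (i : ι) (x : ReducedExponent d) :
    ReducedExponent d :=
  (x.1 + Pi.single i 1, x.2)

theorem ReducedExponent.shift_injective [DecidableEq ι] {d : ι → σ →₀ ℕ} (i : ι) :
    Function.Injective (ReducedExponent.shift (d := d) i) := by
  rintro ⟨α, m⟩ ⟨β, m'⟩ h
  simpa [ReducedExponent.shift] using h

theorem ReducedExponent.poly_shift [Fintype ι] [DecidableEq ι] (P : ι → MvPolynomial σ k)
    {d : ι → σ →₀ ℕ} (i : ι) (x : ReducedExponent d) :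
    (x.shift i).poly P = P i * x.poly P := by
  simp only [ReducedExponent.poly, ReducedExponent.shift, Pi.add_apply, pow_add,
    Finset.prod_mul_distrib]
  have : ∏ j, P j ^ (Pi.single i 1 : ι → ℕ) j = P i := by
    rw [Finset.prod_eq_single i] <;> simp +contextual
  rw [this]; ring

/-- Polynomials with pairwise coprime nontrivial leading exponents generate, together with
the monomials divisible by none of the leading monomials, a basis of the polynomial ring. -/
noncomputable def reducedBasis [Fintype ι] {P : ι → MvPolynomial σ k} {d : ι → σ →₀ ℕ}
    (hP : ∀ i, HasLeadingExponent w (P i) (d i)) (hd0 : ∀ i, d i ≠ 0)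
    (hd : Pairwise fun i j => Disjoint (d i).support (d j).support) :
    Module.Basis (ReducedExponent d) k (MvPolynomial σ k) :=
  have h : ∀ x : ReducedExponent d, HasLeadingExponent w (x.poly P) x.total := fun _ =>
    (HasLeadingExponent.prod _ fun i _ => (hP i).pow _).mul (hasLeadingExponent_monomial _)
  Module.Basis.mk (linearIndependent_of_hasLeadingExponent h (ReducedExponent.total_injective hd))
    (span_eq_top_of_hasLeadingExponent h (ReducedExponent.total_surjective hd0))

theorem mem_span_image_iff_reducedBasis_repr [Fintype ι] {P : ι → MvPolynomial σ k}
    {d : ι → σ →₀ ℕ} (hP : ∀ i, HasLeadingExponent w (P i) (d i)) (hd0 : ∀ i, d i ≠ 0)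
    (hd : Pairwise fun i j => Disjoint (d i).support (d j).support) (τ : Set ι)
    (h : MvPolynomial σ k) :
    h ∈ Ideal.span (P '' τ) ↔ ∀ x : ReducedExponent d, (∀ t ∈ τ, x.1 t = 0) →
      (reducedBasis hP hd0 hd).repr h x = 0 := by
  classical
  set b := reducedBasis hP hd0 hd with hb
  have hbx : ∀ x, b x = x.poly P := fun x => by simp [hb, reducedBasis]
  have hspan : h ∈ Submodule.span k (b '' {x | ∃ t ∈ τ, x.1 t ≠ 0}) ↔
      ∀ x : ReducedExponent d, (∀ t ∈ τ, x.1 t = 0) → b.repr h x = 0 := by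
    rw [Module.Basis.mem_span_image]
    constructor
    · intro hs x hx
      by_contra hne
      obtain ⟨t, ht, hxt⟩ := hs (Finsupp.mem_support_iff.2 hne)
      exact hxt (hx t ht)
    · intro hs x hx
      by_contra hne
      simp only [Set.mem_ofPred_eq, not_exists, not_and, not_not] at hne
      exact Finsupp.mem_support_iff.1 hx (hs x hne)
  rw [← hspan]
  constructor
  · intro hh
    suffices H : ∀ r, r * h ∈ Submodule.span k (b '' {x | ∃ t ∈ τ, x.1 t ≠ 0}) by
      simpa using H 1
    refine Submodule.span_induction (p := fun h _ => ∀ r,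
      r * h ∈ Submodule.span k (b '' {x | ∃ t ∈ τ, x.1 t ≠ 0})) ?_ ?_ ?_ ?_ hh
    · rintro _ ⟨t, ht, rfl⟩ r
      have hr : r ∈ Submodule.span k (Set.range b) := by rw [b.span_eq]; trivial
      refine Submodule.span_induction ?_ (by simp) (fun x y _ _ hx hy => ?_)
        (fun c x _ hx => ?_) hr
      · rintro _ ⟨x, rfl⟩
        refine Submodule.subset_span ⟨x.shift t, ⟨t, ht, by simp [ReducedExponent.shift]⟩, ?_⟩
        rw [hbx, hbx, ReducedExponent.poly_shift, mul_comm]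
      · rw [add_mul]; exact add_mem hx hy
      · rw [smul_mul_assoc]; exact Submodule.smul_mem _ _ hx
    · simp
    · intro x y _ _ hx hy r
      rw [mul_add]; exact add_mem (hx r) (hy r)
    · intro s x _ hx r
      rw [smul_eq_mul, ← mul_assoc]; exact hx _
  · intro hh
    have hle : Submodule.span k (b '' {x | ∃ t ∈ τ, x.1 t ≠ 0}) ≤
        (Ideal.span (P '' τ)).restrictScalars k := by
      rw [Submodule.span_le]
      rintro _ ⟨x, ⟨t, ht, hxt⟩, rfl⟩
      rw [hbx]
      refine Ideal.mul_mem_right _ _ (Ideal.mem_of_dvd _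
        ((dvd_pow_self (P t) hxt).trans
          (Finset.dvd_prod_of_mem (fun i => P i ^ x.1 i) (Finset.mem_univ t)))
        (Ideal.subset_span ⟨t, ht, rfl⟩))
    exact hle hh

/-- If finitely many polynomials have pairwise coprime leading monomials, each of them is a
nonzerodivisor modulo the ideal generated by any set of the others. -/
theorem mem_span_image_of_mul_mem [Finite ι] {P : ι → MvPolynomial σ k}
    {d : ι → σ →₀ ℕ} (hP : ∀ i, HasLeadingExponent w (P i) (d i)) (hd0 : ∀ i, d i ≠ 0)
    (hd : Pairwise fun i j => Disjoint (d i).support (d j).support) (τ : Set ι) {s : ι}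
    (hs : s ∉ τ) {h : MvPolynomial σ k} (hh : P s * h ∈ Ideal.span (P '' τ)) :
    h ∈ Ideal.span (P '' τ) := by
  classical
  have := Fintype.ofFinite ι
  rw [mem_span_image_iff_reducedBasis_repr hP hd0 hd] at hh ⊢
  set b := reducedBasis hP hd0 hd with hb
  have hmap : b.repr.toLinearMap ∘ₗ LinearMap.mulLeft k (P s) =
      Finsupp.lmapDomain k k (ReducedExponent.shift s) ∘ₗ b.repr.toLinearMap := by
    refine b.ext fun x => ?_
    have : P s * b x = b (x.shift s) := by simp [hb, reducedBasis, ReducedExponent.poly_shift]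
    simp [this]
  intro x hx
  have h1 := hh (x.shift s) fun t ht => by
    have : t ≠ s := fun h => hs (h ▸ ht)
    simp [ReducedExponent.shift, hx t ht, this]
  have h2 := DFunLike.congr_fun (LinearMap.congr_fun hmap h) (x.shift s)
  simp only [LinearMap.comp_apply, LinearMap.mulLeft_apply, LinearEquiv.coe_coe,
    Finsupp.lmapDomain_apply, Finsupp.mapDomain_apply (ReducedExponent.shift_injective s)] at h2
  rw [← h2, h1]

/-- The ideal generated by `n` polynomials with pairwise coprime leading monomials has height
at least `n`. -/
theorem card_le_height_span_image [Finite ι] {P : ι → MvPolynomial σ k}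
    {d : ι → σ →₀ ℕ} (hP : ∀ i, HasLeadingExponent w (P i) (d i)) (hd0 : ∀ i, d i ≠ 0)
    (hd : Pairwise fun i j => Disjoint (d i).support (d j).support) (τ : Finset ι) :
    (τ.card : ℕ∞) ≤ (Ideal.span (P '' (τ : Set ι))).height := by
  classical
  induction τ using Finset.induction_on with
  | empty => simp
  | insert s τ hs ih =>
    rw [Finset.card_insert_of_notMem hs, Ideal.height_eq_inf_minimalPrimes]
    refine le_iInf₂ fun Q hQ => ?_
    have := hQ.isPrime
    have hle : Ideal.span (P '' (τ : Set ι)) ≤ Q :=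
      (Ideal.span_mono (Set.image_mono (by simp))).trans hQ.1.2
    obtain ⟨Q₀, hQ₀, hQ₀Q⟩ := Ideal.exists_minimalPrimes_le hle
    have := hQ₀.isPrime
    have hsQ₀ : P s ∉ Q₀ := by
      intro hmem
      obtain ⟨y, hy, hxy⟩ := Ideal.exists_mul_mem_of_mem_minimalPrimes hQ₀ hmem
      exact hy (mem_span_image_of_mul_mem hP hd0 hd _ (by simpa using hs) hxy)
    have hlt : Q₀ < Q := lt_of_le_of_ne hQ₀Q fun h => hsQ₀ <| by
      rw [h]
      exact hQ.1.2 (Ideal.subset_span ⟨s, by simp, rfl⟩)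
    have h1 : (τ.card : ℕ∞) ≤ Q₀.height := ih.trans (Ideal.height_mono hQ₀.1.2)
    push_cast
    exact (add_le_add_left h1 1).trans (Ideal.height_add_one_le_of_lt_of_isPrime hlt)

end LeadingExponents

theorem height_add_ringKrullDim_quotient_le {R : Type*} [CommRing R] (p : Ideal R)
    [hp : p.IsPrime] : (p.height : WithBot ℕ∞) + ringKrullDim (R ⧸ p) ≤ ringKrullDim R := by
  have : Nonempty (PrimeSpectrum R) := ⟨⟨p, hp⟩⟩
  have h1 : ringKrullDim (R ⧸ p) = Order.coheight (⟨p, hp⟩ : PrimeSpectrum R) := by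
    rw [ringKrullDim_quotient, Order.coheight_eq_krullDim_Ici]
    rfl
  rw [h1, PrimeSpectrum.height_eq_orderHeight ⟨p, hp⟩, ringKrullDim,
    Order.krullDim_eq_iSup_height_add_coheight_of_nonempty, ← WithBot.coe_add, WithBot.coe_le_coe]
  exact le_iSup (fun q : PrimeSpectrum R => Order.height q + Order.coheight q) ⟨p, hp⟩

section Origin

variable (σ k : Type*) [Field k]

theorem isPrime_span_range_X : (Ideal.span (Set.range (X : σ → MvPolynomial σ k))).IsPrime := by
  have h : Ideal.span (Set.range (X : σ → MvPolynomial σ k)) =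
      RingHom.ker (constantCoeff : MvPolynomial σ k →+* k) := by
    ext p
    rw [← Set.image_univ, mem_ideal_span_X_image, RingHom.mem_ker, constantCoeff_eq,
      ← notMem_support_iff]
    constructor
    · intro h h0
      obtain ⟨i, -, hi⟩ := h 0 h0
      exact hi rfl
    · intro h m hm
      by_contra! hne
      have : m = 0 := Finsupp.ext fun i => hne i (Set.mem_univ i)
      exact h (this ▸ hm)
  rw [h]
  exact RingHom.ker_isPrime _

theorem card_le_height_span_range_X [Fintype σ] :
    (Fintype.card σ : ℕ∞) ≤ (Ideal.span (Set.range (X : σ → MvPolynomial σ k))).height := by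
  classical
  have h := card_le_height_span_image (w := 0) (P := (X : σ → MvPolynomial σ k))
    (d := fun s => Finsupp.single s 1) (fun s => hasLeadingExponent_monomial _) (by simp)
    (fun i j hij => by simpa [Finsupp.support_single] using hij) Finset.univ
  simpa using h

/-- A quotient of a polynomial ring by `n` polynomials without constant term loses at most `n`
dimensions. -/
theorem card_le_ringKrullDim_quotient_add_encard [Fintype σ] (s : Set (MvPolynomial σ k))
    (hs : s ⊆ Ideal.span (Set.range (X : σ → MvPolynomial σ k))) :
    (Fintype.card σ : WithBot ℕ∞) ≤ ringKrullDim (MvPolynomial σ k ⧸ Ideal.span s) + s.encard := by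
  have := isPrime_span_range_X σ k
  refine le_trans ?_ (Ideal.height_le_ringKrullDim_quotient_add_encard s hs)
  exact_mod_cast card_le_height_span_range_X σ k

end Origin

section GenericComplex

variable (k : Type*) [Field k] (a n g : ℕ)

/-- The square matrix formed by the last `g` rows of the generic `(n + g) × g` matrix. -/
noncomputable def bottomBlock :
    Matrix (Fin g) (Fin g) (MvPolynomial ((Fin a × Fin (n + g)) ⊕ (Fin (n + g) × Fin g)) k) :=
  Matrix.of fun p q => X (Sum.inr (Fin.natAdd n p, q))

/-- The matrix formed by the first `n` rows of the generic `(n + g) × g` matrix. -/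
noncomputable def topBlock :
    Matrix (Fin n) (Fin g) (MvPolynomial ((Fin a × Fin (n + g)) ⊕ (Fin (n + g) × Fin g)) k) :=
  Matrix.of fun p q => X (Sum.inr (Fin.castAdd g p, q))

/-- The matrix formed by the first `n` columns of the generic `a × (n + g)` matrix. -/
noncomputable def leftBlock :
    Matrix (Fin a) (Fin n) (MvPolynomial ((Fin a × Fin (n + g)) ⊕ (Fin (n + g) × Fin g)) k) :=
  Matrix.of fun i p => X (Sum.inl (i, Fin.castAdd g p))

/-- The matrix formed by the last `g` columns of the generic `a × (n + g)` matrix. -/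
noncomputable def rightBlock :
    Matrix (Fin a) (Fin g) (MvPolynomial ((Fin a × Fin (n + g)) ⊕ (Fin (n + g) × Fin g)) k) :=
  Matrix.of fun i p => X (Sum.inl (i, Fin.natAdd n p))

/-- Weights for which the `(i, j)` entry of the generic product has leading monomial
`x_{i,i+j} y_{i+j,j}`, and the bottom block has determinant with diagonal leading monomial. -/
def complexWeight (a f g : ℕ) : (Fin a × Fin f) ⊕ (Fin f × Fin g) → ℕ
  | Sum.inl (i, l) => f * f + 2 * i * l - l * l
  | Sum.inr (l, j) => 2 * l * j

/-- The generators of the generic complex ideal together with the determinant of the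
bottom block. -/
noncomputable def complexFamily : Option (Fin a × Fin g) →
    MvPolynomial ((Fin a × Fin (n + g)) ⊕ (Fin (n + g) × Fin g)) k
  | some (i, j) => genericProdEntry k a (n + g) g i j
  | none => (bottomBlock k a n g).det

variable {a n g}

/-- The leading exponents of the members of `complexFamily`. -/
noncomputable def complexExponent (han : a ≤ n) : Option (Fin a × Fin g) →
    ((Fin a × Fin (n + g)) ⊕ (Fin (n + g) × Fin g)) →₀ ℕ
  | some (i, j) => Finsupp.single (Sum.inl (i, ⟨i + j, by omega⟩)) 1 +
      Finsupp.single (Sum.inr (⟨i + j, by omega⟩, j)) 1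
  | none => ∑ q, Finsupp.single (Sum.inr (Fin.natAdd n q, q)) 1

theorem complexExponent_ne_zero (hg : 0 < g) (han : a ≤ n) (s : Option (Fin a × Fin g)) :
    complexExponent han s ≠ 0 := by
  intro h
  cases s with
  | none =>
    have h1 := DFunLike.congr_fun h (Sum.inr (Fin.natAdd n ⟨0, hg⟩, ⟨0, hg⟩))
    simp only [complexExponent, Finsupp.finsetSum_apply, Finsupp.coe_zero, Pi.zero_apply,
      Finset.sum_eq_zero_iff] at h1
    simpa using h1 ⟨0, hg⟩ (Finset.mem_univ _)
  | some s =>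
    have h1 := DFunLike.congr_fun h (Sum.inl (s.1, ⟨s.1 + s.2, by omega⟩))
    simp [complexExponent] at h1

theorem mem_support_complexExponent_some (han : a ≤ n) (i : Fin a) (j : Fin g)
    (v : (Fin a × Fin (n + g)) ⊕ (Fin (n + g) × Fin g)) :
    v ∈ (complexExponent han (some (i, j))).support ↔
      v = Sum.inl (i, ⟨i + j, by omega⟩) ∨ v = Sum.inr (⟨i + j, by omega⟩, j) := by
  classical
  simp only [complexExponent, Finsupp.mem_support_iff, Finsupp.add_apply, Finsupp.single_apply]
  split_ifs <;> simp_all [eq_comm]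

theorem exists_of_mem_support_complexExponent_none (han : a ≤ n)
    {v : (Fin a × Fin (n + g)) ⊕ (Fin (n + g) × Fin g)}
    (hv : v ∈ (complexExponent (g := g) han none).support) :
    ∃ q : Fin g, v = Sum.inr (Fin.natAdd n q, q) := by
  classical
  by_contra! h
  refine Finsupp.mem_support_iff.1 hv ?_
  rw [complexExponent, Finsupp.finsetSum_apply]
  exact Finset.sum_eq_zero fun q _ => Finsupp.single_eq_of_ne (h q)

theorem pairwise_disjoint_support_complexExponent (han : a ≤ n) :
    Pairwise fun s t : Option (Fin a × Fin g) =>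
      Disjoint (complexExponent han s).support (complexExponent han t).support := by
  have hsn : ∀ s : Fin a × Fin g, Disjoint (complexExponent han (some s)).support
      (complexExponent (g := g) han none).support := by
    rintro ⟨i, j⟩
    rw [Finset.disjoint_left]
    intro v hv hv'
    obtain ⟨q, rfl⟩ := exists_of_mem_support_complexExponent_none han hv'
    rw [mem_support_complexExponent_some] at hv
    simp only [reduceCtorEq, Sum.inr.injEq, Prod.mk.injEq, Fin.ext_iff, Fin.val_natAdd,
      false_or] at hv
    omega
  rintro (_ | s) (_ | t) hst
  · exact absurd rfl hst
  · exact (hsn t).symm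
  · exact hsn s
  · obtain ⟨i, j⟩ := s
    obtain ⟨i', j'⟩ := t
    rw [Finset.disjoint_left]
    intro v hv hv'
    rw [mem_support_complexExponent_some] at hv hv'
    apply hst
    rcases hv with rfl | rfl <;>
    · simp only [reduceCtorEq, Sum.inr.injEq, Sum.inl.injEq, Prod.mk.injEq, Fin.ext_iff,
        false_or, or_false] at hv'
      have h1 : i = i' := Fin.ext (by omega)
      have h2 : j = j' := Fin.ext (by omega)
      rw [h1, h2]

theorem weight_complexWeight_lt (i : Fin a) (j : Fin g) (hij : (i : ℕ) + j < n + g)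
    (l : Fin (n + g)) (hl : l ≠ ⟨i + j, hij⟩) :
    Finsupp.weight (complexWeight a (n + g) g)
        (Finsupp.single (Sum.inl (i, l)) 1 + Finsupp.single (Sum.inr (l, j)) 1) <
      Finsupp.weight (complexWeight a (n + g) g)
        (Finsupp.single (Sum.inl (i, (⟨i + j, hij⟩ : Fin (n + g)))) 1 +
          Finsupp.single (Sum.inr ((⟨i + j, hij⟩ : Fin (n + g)), j)) 1) := by
  simp only [map_add, Finsupp.weight_single, one_smul, complexWeight]
  have hl' : (l : ℕ) ≠ i + j := fun h => hl (Fin.ext h)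
  have h1 : (l : ℕ) * l ≤ (n + g) * (n + g) := Nat.mul_le_mul l.2.le l.2.le
  have h2 : ((i : ℕ) + j) * (i + j) ≤ (n + g) * (n + g) :=
    Nat.mul_le_mul (by omega) (by omega)
  zify [h1.trans (Nat.le_add_right _ (2 * i * l)),
    h2.trans (Nat.le_add_right _ (2 * i * (i + j)))]
  have h3 : (0 : ℤ) < ((l : ℤ) - (i + j)) ^ 2 := by
    have : (l : ℤ) - (i + j) ≠ 0 := by omega
    positivity
  nlinarith

theorem hasLeadingExponent_genericProdEntry (han : a ≤ n) (i : Fin a) (j : Fin g) :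
    HasLeadingExponent (complexWeight a (n + g) g) (genericProdEntry k a (n + g) g i j)
      (complexExponent han (some (i, j))) := by
  have hij : (i : ℕ) + j < n + g := by omega
  have h : genericProdEntry k a (n + g) g i j = ∑ l : Fin (n + g),
      monomial (Finsupp.single (Sum.inl (i, l)) 1 + Finsupp.single (Sum.inr (l, j)) 1) (1 : k) := by
    refine Finset.sum_congr rfl fun l _ => ?_
    simp [X]
  have he : complexExponent han (some (i, j)) = Finsupp.single (Sum.inl (i, ⟨i + j, hij⟩)) 1 +
      Finsupp.single (Sum.inr (⟨i + j, hij⟩, j)) 1 := rfl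
  rw [h, he]
  exact hasLeadingExponent_sum (ι := Fin (n + g)) (w := complexWeight a (n + g) g)
    (fun _ => (1 : k))
    (fun l => Finsupp.single (Sum.inl (i, l)) 1 + Finsupp.single (Sum.inr (l, j)) 1)
    ⟨i + j, hij⟩ rfl (weight_complexWeight_lt i j hij)

theorem hasLeadingExponent_det_bottomBlock (han : a ≤ n) :
    HasLeadingExponent (complexWeight a (n + g) g) (bottomBlock k a n g).det
      (complexExponent han none) := by
  classical
  have h : (bottomBlock k a n g).det = ∑ π : Equiv.Perm (Fin g),
      monomial (∑ q, Finsupp.single (Sum.inr (Fin.natAdd n (π q), q)) 1)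
        (((Equiv.Perm.sign π : ℤ) : k)) := by
    rw [Matrix.det_apply']
    refine Finset.sum_congr rfl fun π _ => ?_
    rw [← mul_one (((Equiv.Perm.sign π : ℤ) : k)), ← C_mul_monomial, monomial_sum_one]
    simp [bottomBlock, X]
  rw [h]
  refine hasLeadingExponent_sum (fun π : Equiv.Perm (Fin g) => ((Equiv.Perm.sign π : ℤ) : k))
    (fun π => ∑ q, Finsupp.single (Sum.inr (Fin.natAdd n (π q), q)) 1)
    1 (by simp) fun π hπ => ?_
  simp only [map_sum, Finsupp.weight_single, one_smul, complexWeight, Equiv.Perm.coe_one, id_eq,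
    Fin.val_natAdd]
  have hpos : (0 : ℤ) < ∑ q, ((π q : ℤ) - q) ^ 2 := by
    refine Finset.sum_pos' (fun q _ => sq_nonneg _) ?_
    by_contra! hle
    refine hπ (Equiv.ext fun q => Fin.ext ?_)
    have h0 := hle q (Finset.mem_univ q)
    have : ((π q : ℤ) - q) = 0 := by
      by_contra hne
      have : 0 < ((π q : ℤ) - q) ^ 2 := by positivity
      omega
    simp only [Equiv.Perm.coe_one, id_eq]
    omega
  have hsq : ∑ q, ((π q : ℕ) : ℤ) ^ 2 = ∑ q : Fin g, ((q : ℕ) : ℤ) ^ 2 :=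
    Equiv.sum_comp π fun q : Fin g => ((q : ℕ) : ℤ) ^ 2
  zify
  have h1 : ∑ q : Fin g, (2 * ((n : ℤ) + (q : ℕ)) * (q : ℕ)) -
      ∑ q : Fin g, (2 * ((n : ℤ) + (π q : ℕ)) * (q : ℕ)) = ∑ q, ((π q : ℤ) - q) ^ 2 := by
    have : ∀ q : Fin g, ((π q : ℤ) - q) ^ 2 = (2 * ((n : ℤ) + (q : ℕ)) * (q : ℕ)) -
      (2 * ((n : ℤ) + (π q : ℕ)) * (q : ℕ)) + (((π q : ℕ) : ℤ) ^ 2 - ((q : ℕ) : ℤ) ^ 2) := by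
      intro q; ring
    rw [Finset.sum_congr rfl fun q _ => this q, Finset.sum_add_distrib, Finset.sum_sub_distrib,
      Finset.sum_sub_distrib, hsq]
    ring
  linarith

theorem hasLeadingExponent_complexFamily (han : a ≤ n) (s : Option (Fin a × Fin g)) :
    HasLeadingExponent (complexWeight a (n + g) g) (complexFamily k a n g s)
      (complexExponent han s) := by
  cases s with
  | none => exact hasLeadingExponent_det_bottomBlock k han
  | some s => exact hasLeadingExponent_genericProdEntry k han s.1 s.2

variable (a n g)

theorem genericComplexIdeal_eq_span_image : genericComplexIdeal k a (n + g) g =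
    Ideal.span (complexFamily k a n g ''
      ((Finset.univ.map Function.Embedding.some : Finset (Option (Fin a × Fin g))) : Set _)) := by
  rw [genericComplexIdeal]
  congr 1
  ext P
  constructor
  · rintro ⟨i, j, rfl⟩
    exact ⟨some (i, j), by simp, rfl⟩
  · rintro ⟨_ | ⟨i, j⟩, h, rfl⟩
    · simp at h
    · exact ⟨i, j, rfl⟩

theorem blocks_mul_apply (i : Fin a) (j : Fin g) :
    (leftBlock k a n g * topBlock k a n g + rightBlock k a n g * bottomBlock k a n g) i j =
      genericProdEntry k a (n + g) g i j := by
  simp [Matrix.mul_apply, genericProdEntry, Fin.sum_univ_add, leftBlock, topBlock, rightBlock,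
    bottomBlock]

theorem det_bottomBlock_mul_X_add_mem (i : Fin a) (p : Fin g) :
    (bottomBlock k a n g).det * X (Sum.inl (i, Fin.natAdd n p)) +
      (leftBlock k a n g * topBlock k a n g * (bottomBlock k a n g).adjugate) i p ∈
        genericComplexIdeal k a (n + g) g := by
  have h : (bottomBlock k a n g).det • rightBlock k a n g +
      leftBlock k a n g * topBlock k a n g * (bottomBlock k a n g).adjugate =
      (leftBlock k a n g * topBlock k a n g + rightBlock k a n g * bottomBlock k a n g) *
        (bottomBlock k a n g).adjugate := by
    rw [Matrix.add_mul, Matrix.mul_assoc (rightBlock k a n g), Matrix.mul_adjugate, Matrix.mul_smul,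
      Matrix.mul_one]
    exact add_comm _ _
  have h' := congrFun (congrFun h i) p
  simp only [Matrix.add_apply, Matrix.smul_apply, smul_eq_mul] at h'
  rw [show rightBlock k a n g i p = X (Sum.inl (i, Fin.natAdd n p)) from rfl] at h'
  rw [h', Matrix.mul_apply]
  refine sum_mem fun j _ => Ideal.mul_mem_right _ _ ?_
  rw [blocks_mul_apply]
  exact Ideal.subset_span ⟨i, j, rfl⟩

/-- The parametrization of the generic complex obtained by solving for the last `g` columns of
the first matrix. -/
noncomputable def complexParam :
    MvPolynomial ((Fin a × Fin (n + g)) ⊕ (Fin (n + g) × Fin g)) k →ₐ[k]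
      FractionRing (MvPolynomial ((Fin a × Fin (n + g)) ⊕ (Fin (n + g) × Fin g)) k) :=
  aeval <| Sum.elim
    (fun il => Fin.addCases (motive := fun _ => FractionRing
        (MvPolynomial ((Fin a × Fin (n + g)) ⊕ (Fin (n + g) × Fin g)) k))
      (fun p => algebraMap (MvPolynomial ((Fin a × Fin (n + g)) ⊕ (Fin (n + g) × Fin g)) k) _
        (X (Sum.inl (il.1, Fin.castAdd g p))))
      (fun p => -algebraMap _ _ ((leftBlock k a n g * topBlock k a n g *
        (bottomBlock k a n g).adjugate) il.1 p) / algebraMap _ _ (bottomBlock k a n g).det) il.2)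
    (fun lj => algebraMap (MvPolynomial ((Fin a × Fin (n + g)) ⊕ (Fin (n + g) × Fin g)) k) _
      (X (Sum.inr lj)))

/-- The subalgebra on which `complexParam` is the inclusion into the fraction field. -/
noncomputable def complexParamFixed :
    Subalgebra k (MvPolynomial ((Fin a × Fin (n + g)) ⊕ (Fin (n + g) × Fin g)) k) :=
  AlgHom.equalizer (complexParam k a n g) (IsScalarTower.toAlgHom k _ _)

variable {a n g}

theorem mem_complexParamFixed {h : MvPolynomial ((Fin a × Fin (n + g)) ⊕ (Fin (n + g) × Fin g)) k} :
    h ∈ complexParamFixed k a n g ↔ complexParam k a n g h = algebraMap _ _ h :=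
  Iff.rfl

theorem X_inr_mem_complexParamFixed (v : Fin (n + g) × Fin g) :
    X (Sum.inr v) ∈ complexParamFixed k a n g := by
  simp [mem_complexParamFixed, complexParam]

theorem X_inl_castAdd_mem_complexParamFixed (i : Fin a) (p : Fin n) :
    X (Sum.inl (i, Fin.castAdd g p)) ∈ complexParamFixed k a n g := by
  simp [mem_complexParamFixed, complexParam]

theorem adjugate_bottomBlock_apply_mem_complexParamFixed (p q : Fin g) :
    (bottomBlock k a n g).adjugate p q ∈ complexParamFixed k a n g := by
  classical
  rw [Matrix.adjugate_apply, Matrix.det_apply]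
  refine sum_mem fun π _ => ?_
  rw [Units.smul_def]
  refine zsmul_mem (prod_mem fun r _ => ?_) _
  rw [Matrix.updateRow_apply]
  split_ifs
  · rw [Pi.single_apply]
    split_ifs
    · exact one_mem _
    · exact zero_mem _
  · exact X_inr_mem_complexParamFixed k _

theorem det_bottomBlock_mem_complexParamFixed :
    (bottomBlock k a n g).det ∈ complexParamFixed k a n g := by
  rw [Matrix.det_apply]
  refine sum_mem fun π _ => ?_
  rw [Units.smul_def]
  exact zsmul_mem (prod_mem fun r _ => X_inr_mem_complexParamFixed k _) _

theorem blocks_mul_adjugate_mem_complexParamFixed (i : Fin a) (p : Fin g) :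
    (leftBlock k a n g * topBlock k a n g * (bottomBlock k a n g).adjugate) i p ∈
      complexParamFixed k a n g := by
  rw [Matrix.mul_apply]
  refine sum_mem fun q _ => mul_mem ?_ (adjugate_bottomBlock_apply_mem_complexParamFixed k _ _)
  rw [Matrix.mul_apply]
  exact sum_mem fun l _ => mul_mem (X_inl_castAdd_mem_complexParamFixed k _ _)
    (X_inr_mem_complexParamFixed k _)

theorem det_bottomBlock_mul_mem (hg : 0 < g) (han : a ≤ n)
    {h : MvPolynomial ((Fin a × Fin (n + g)) ⊕ (Fin (n + g) × Fin g)) k}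
    (hh : (bottomBlock k a n g).det * h ∈ genericComplexIdeal k a (n + g) g) :
    h ∈ genericComplexIdeal k a (n + g) g := by
  rw [genericComplexIdeal_eq_span_image] at hh ⊢
  exact mem_span_image_of_mul_mem (s := none) (hasLeadingExponent_complexFamily k han)
    (complexExponent_ne_zero hg han) (pairwise_disjoint_support_complexExponent han) _
    (by simp) hh

theorem det_bottomBlock_ne_zero : (bottomBlock k a n g).det ≠ 0 := by
  intro h
  let φ : MvPolynomial ((Fin a × Fin (n + g)) ⊕ (Fin (n + g) × Fin g)) k →+* k :=
    (aeval (Sum.elim (fun _ => (0 : k)) fun lj => if lj.1 = Fin.natAdd n lj.2 then 1 else 0)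
      ).toRingHom
  have h1 : φ.mapMatrix (bottomBlock k a n g) = 1 := by
    ext p q
    simp [φ, bottomBlock, Matrix.one_apply]
  have h2 := congrArg φ h
  rw [RingHom.map_det, h1] at h2
  simp at h2

theorem complexParam_genericProdEntry (i : Fin a) (j : Fin g) :
    complexParam k a n g (genericProdEntry k a (n + g) g i j) = 0 := by
  have hD : algebraMap _ (FractionRing
      (MvPolynomial ((Fin a × Fin (n + g)) ⊕ (Fin (n + g) × Fin g)) k))
      (bottomBlock k a n g).det ≠ 0 := by
    rw [Ne, FaithfulSMul.algebraMap_eq_zero_iff]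
    exact det_bottomBlock_ne_zero k
  have h1 : genericProdEntry k a (n + g) g i j = (leftBlock k a n g * topBlock k a n g) i j +
      ∑ p, X (Sum.inl (i, Fin.natAdd n p)) * bottomBlock k a n g p j := by
    rw [← blocks_mul_apply, Matrix.add_apply, Matrix.mul_apply (M := rightBlock k a n g)]
    rfl
  have h2 : ∀ p : Fin g, complexParam k a n g (X (Sum.inl (i, Fin.natAdd n p))) =
      -algebraMap _ _ ((leftBlock k a n g * topBlock k a n g *
        (bottomBlock k a n g).adjugate) i p) / algebraMap _ _ (bottomBlock k a n g).det := by
    intro p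
    simp [complexParam]
  have h3 : (leftBlock k a n g * topBlock k a n g) i j ∈ complexParamFixed k a n g := by
    rw [Matrix.mul_apply]
    exact sum_mem fun l _ => mul_mem (X_inl_castAdd_mem_complexParamFixed k _ _)
      (X_inr_mem_complexParamFixed k _)
  have h4 : ∀ p, complexParam k a n g (bottomBlock k a n g p j) =
      algebraMap _ _ (bottomBlock k a n g p j) := fun p => X_inr_mem_complexParamFixed k _
  have h5 : ∑ p, (leftBlock k a n g * topBlock k a n g * (bottomBlock k a n g).adjugate) i p *
      bottomBlock k a n g p j =
      (bottomBlock k a n g).det * (leftBlock k a n g * topBlock k a n g) i j := by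
    rw [← Matrix.mul_apply, Matrix.mul_assoc, Matrix.adjugate_mul, Matrix.mul_smul, Matrix.mul_one,
      Matrix.smul_apply, smul_eq_mul]
  rw [h1, map_add, (mem_complexParamFixed k).1 h3, map_sum]
  simp only [map_mul, h2, h4]
  rw [← mul_right_inj' hD, mul_add, Finset.mul_sum, mul_zero, ← map_mul, ← h5, map_sum,
    ← Finset.sum_add_distrib]
  refine Finset.sum_eq_zero fun p _ => ?_
  rw [map_mul]
  field_simp
  ring

theorem genericComplexIdeal_eq_ker (hg : 0 < g) (han : a ≤ n) :
    genericComplexIdeal k a (n + g) g = RingHom.ker (complexParam k a n g) := by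
  have hle : genericComplexIdeal k a (n + g) g ≤ RingHom.ker (complexParam k a n g) := by
    rw [genericComplexIdeal, Ideal.span_le]
    rintro _ ⟨i, j, rfl⟩
    exact complexParam_genericProdEntry k i j
  refine le_antisymm hle fun h hh => ?_
  set D := (bottomBlock k a n g).det with hDdef
  have hD : D ∈ complexParamFixed k a n g := det_bottomBlock_mem_complexParamFixed k
  have key : ∃ N : ℕ, ∃ h' ∈ complexParamFixed k a n g,
      D ^ N * h - h' ∈ genericComplexIdeal k a (n + g) g := by
    clear hh
    induction h using MvPolynomial.induction_on with
    | C c => exact ⟨0, C c, Subalgebra.algebraMap_mem _ c, by simp⟩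
    | add p q hp hq =>
      obtain ⟨N, p', hp', hpN⟩ := hp
      obtain ⟨M, q', hq', hqM⟩ := hq
      refine ⟨N + M, D ^ M * p' + D ^ N * q', add_mem (mul_mem (pow_mem hD _) hp')
        (mul_mem (pow_mem hD _) hq'), ?_⟩
      convert add_mem (Ideal.mul_mem_left _ (D ^ M) hpN) (Ideal.mul_mem_left _ (D ^ N) hqM) using 1
      ring
    | mul_X p v hp =>
      obtain ⟨N, p', hp', hpN⟩ := hp
      have hv : ∃ v' ∈ complexParamFixed k a n g,
          D * X v - v' ∈ genericComplexIdeal k a (n + g) g := by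
        rcases v with ⟨i, l⟩ | v
        · induction l using Fin.addCases with
          | left l =>
            exact ⟨_, mul_mem hD (X_inl_castAdd_mem_complexParamFixed k i l), by simp⟩
          | right l =>
            refine ⟨_, neg_mem (blocks_mul_adjugate_mem_complexParamFixed k i l), ?_⟩
            rw [sub_neg_eq_add]
            exact det_bottomBlock_mul_X_add_mem k a n g i l
        · exact ⟨_, mul_mem hD (X_inr_mem_complexParamFixed k v), by simp⟩
      obtain ⟨v', hv', hvD⟩ := hv
      refine ⟨N + 1, p' * v', mul_mem hp' hv', ?_⟩
      convert add_mem (Ideal.mul_mem_left _ (D * X v) hpN) (Ideal.mul_mem_left _ p' hvD) using 1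
      ring
  obtain ⟨N, h', hh', hN⟩ := key
  have h0 : h' = 0 := by
    have h1 := hle hN
    rw [RingHom.mem_ker] at h1 hh
    rw [map_sub, map_mul, hh, mul_zero, zero_sub, neg_eq_zero, (mem_complexParamFixed k).1 hh',
      FaithfulSMul.algebraMap_eq_zero_iff] at h1
    exact h1
  rw [h0, sub_zero] at hN
  clear hh' h0 hh
  induction N with
  | zero => simpa using hN
  | succ N ih =>
    refine ih (det_bottomBlock_mul_mem k hg han ?_)
    rwa [← mul_assoc, ← pow_succ']

theorem isPrime_genericComplexIdeal (hg : 0 < g) (han : a ≤ n) :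
    (genericComplexIdeal k a (n + g) g).IsPrime := by
  rw [genericComplexIdeal_eq_ker k hg han]
  exact RingHom.ker_isPrime _

theorem mul_le_height_genericComplexIdeal (hg : 0 < g) (han : a ≤ n) :
    ((a * g : ℕ) : ℕ∞) ≤ (genericComplexIdeal k a (n + g) g).height := by
  have h := card_le_height_span_image (hasLeadingExponent_complexFamily k han)
    (complexExponent_ne_zero hg han) (pairwise_disjoint_support_complexExponent han)
    (Finset.univ.map Function.Embedding.some)
  rw [← genericComplexIdeal_eq_span_image] at h
  simpa using h

theorem card_le_ringKrullDim_quotient_genericComplexIdeal_add (a f g : ℕ) :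
    ((a * f + f * g : ℕ) : WithBot ℕ∞) ≤ ringKrullDim
      (MvPolynomial ((Fin a × Fin f) ⊕ (Fin f × Fin g)) k ⧸ genericComplexIdeal k a f g) +
        ((a * g : ℕ) : WithBot ℕ∞) := by
  have hset : {P | ∃ i : Fin a, ∃ j : Fin g, P = genericProdEntry k a f g i j} =
      Set.range fun s : Fin a × Fin g => genericProdEntry k a f g s.1 s.2 := by
    ext P
    simp [eq_comm]
  have h := card_le_ringKrullDim_quotient_add_encard _ k
    {P | ∃ i : Fin a, ∃ j : Fin g, P = genericProdEntry k a f g i j} (by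
      rintro _ ⟨i, j, rfl⟩
      exact sum_mem fun l _ => Ideal.mul_mem_left _ _ (Ideal.subset_span ⟨_, rfl⟩))
  have hcard : {P | ∃ i : Fin a, ∃ j : Fin g, P = genericProdEntry k a f g i j}.encard ≤
      ((a * g : ℕ) : ℕ∞) := by
    rw [hset, ← Set.image_univ]
    refine (Set.encard_image_le _ _).trans ?_
    simp
  simp only [Fintype.card_sum, Fintype.card_prod, Fintype.card_fin] at h
  refine h.trans ?_
  rw [genericComplexIdeal]
  gcongr
  exact_mod_cast hcard

end GenericComplex

/-- If `1 ≤ a ≤ f − g`, then the ideal `I` generated by the `ag` entries of the generic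
matrix product `X·Y` is a prime ideal of height `ag`, and the quotient ring `R/I` is an
integral domain of Krull dimension `fg + a(f − g)`. -/
theorem genericComplexIdeal_isPrime_height_krullDim
    (k : Type*) [Field k] (a f g : ℕ) (ha : 0 < a) (hg : 0 < g) (hafg : a + g ≤ f) :
    ∃ hp : (genericComplexIdeal k a f g).IsPrime,
      Order.height (⟨genericComplexIdeal k a f g, hp⟩ :
          PrimeSpectrum (MvPolynomial ((Fin a × Fin f) ⊕ (Fin f × Fin g)) k))
        = ((a * g : ℕ) : ℕ∞) ∧
      ringKrullDim
          (MvPolynomial ((Fin a × Fin f) ⊕ (Fin f × Fin g)) k ⧸ genericComplexIdeal k a f g)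
        = ((f * g + a * (f - g) : ℕ) : WithBot (WithTop ℕ)) := by
  obtain ⟨n, rfl⟩ : ∃ n, f = n + g := ⟨f - g, by omega⟩
  have han : a ≤ n := by omega
  have hp := isPrime_genericComplexIdeal k hg han
  refine ⟨hp, ?_⟩
  have h1 := mul_le_height_genericComplexIdeal k hg han
  have h2 := card_le_ringKrullDim_quotient_genericComplexIdeal_add k a (n + g) g
  have h3 := height_add_ringKrullDim_quotient_le (genericComplexIdeal k a (n + g) g)
  rw [MvPolynomial.ringKrullDim_of_isNoetherianRing, ringKrullDim_eq_zero_of_field, zero_add,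
    Nat.card_eq_fintype_card] at h3
  simp only [Fintype.card_sum, Fintype.card_prod, Fintype.card_fin] at h3
  rw [← PrimeSpectrum.height_eq_orderHeight]
  change (genericComplexIdeal k a (n + g) g).height = _ ∧ _
  generalize ringKrullDim (MvPolynomial ((Fin a × Fin (n + g)) ⊕ (Fin (n + g) × Fin g)) k ⧸
    genericComplexIdeal k a (n + g) g) = e at h2 h3 ⊢
  generalize (genericComplexIdeal k a (n + g) g).height = h at h1 h3 ⊢
  rw [Nat.add_sub_cancel]
  have he0 : e ≠ ⊥ := by
    rintro rfl
    rw [WithBot.bot_add, le_bot_iff] at h2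
    exact WithBot.natCast_ne_bot _ h2
  lift e to ℕ∞ using he0
  norm_cast at h2 h3 ⊢
  have hh : h ≠ ⊤ := by
    rintro rfl
    rw [top_add, top_le_iff] at h3
    exact ENat.natCast_ne_top _ h3
  have he : e ≠ ⊤ := by
    rintro rfl
    rw [add_top, top_le_iff] at h3
    exact ENat.natCast_ne_top _ h3
  lift h to ℕ using hh
  lift e to ℕ using he
  norm_cast at h1 h2 h3 ⊢
  have hN : a * (n + g) + (n + g) * g = (n + g) * g + a * n + a * g := by ring
  have hh : h = a * g := by omega
  have he : e = (n + g) * g + a * n := by omega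
  exact ⟨hh, by rw [he]; rfl⟩
end

section
/- Suppose 1 ≤ a ≤ f − g. Then the quotient ring R/I by the ideal I generated by the ag entries of the generic matrix product XY is an integrally closed (normal) domain; geometrically, the variety of complexes Z = {(M, L) ∈ Mat_{a×f} × Mat_{f×g} : M·L = 0} is a normal, integral affine variety. -/
open MvPolynomial

namespace MonomialOrder

theorem _root_.Finsupp.le_of_le_add_of_disjoint {σ : Type*} {d e c : σ →₀ ℕ}
    (hde : Disjoint d.support e.support) (h : d ≤ c + e) : d ≤ c := by
  intro i
  by_cases hi : i ∈ d.support
  · have := h i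
    have he : e i = 0 := by
      simpa using Finset.disjoint_left.mp hde hi
    simpa [he] using this
  · simp_all

variable {σ k : Type*} [Field k] (m : MonomialOrder σ) {ι : Type*} {b : ι → MvPolynomial σ k}

theorem exists_reduced_sub_mem_span (s : Set ι) (hb : ∀ i ∈ s, b i ≠ 0) (u : MvPolynomial σ k) :
    ∃ r, u - r ∈ Ideal.span (b '' s) ∧
      ∀ c ∈ r.support, ∀ i ∈ s, ¬ m.degree (b i) ≤ c := by
  obtain ⟨q, r, hq, -, hr⟩ := m.div_set (B := b '' s) (by
    rintro _ ⟨i, hi, rfl⟩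
    exact (m.leadingCoeff_ne_zero_iff.mpr (hb i hi)).isUnit) u
  refine ⟨r, ?_, fun c hc i hi => hr c hc _ ⟨i, hi, rfl⟩⟩
  rw [hq, add_sub_cancel_right, Ideal.span, Finsupp.mem_span_iff_linearCombination]
  exact ⟨q, rfl⟩

theorem exists_degree_le_of_mem_span (s : Finset ι) (hb : ∀ i ∈ s, b i ≠ 0)
    (hd : (s : Set ι).Pairwise fun i j =>
      Disjoint (m.degree (b i)).support (m.degree (b j)).support)
    {u : MvPolynomial σ k} (hu : u ∈ Ideal.span (b '' s)) (hu0 : u ≠ 0) :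
    ∃ i ∈ s, m.degree (b i) ≤ m.degree u := by
  classical
  induction s using Finset.induction_on generalizing u with
  | empty => simp_all
  | insert p s hp ih =>
    have hbs : ∀ i ∈ s, b i ≠ 0 := fun i hi => hb i (Finset.mem_insert_of_mem hi)
    replace ih := @ih hbs (hd.mono (by simp))
    rw [Finset.coe_insert, Set.image_insert_eq, Ideal.mem_span_insert] at hu
    obtain ⟨c', v', hv', rfl⟩ := hu
    obtain ⟨c, hc, hred⟩ := m.exists_reduced_sub_mem_span (s : Set ι) hbs c'
    obtain ⟨v, hv, huv⟩ : ∃ v ∈ Ideal.span (b '' s), c' * b p + v' = c * b p + v :=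
      ⟨(c' - c) * b p + v', add_mem (Ideal.mul_mem_right _ _ hc) hv', by ring⟩
    rw [huv] at hu0 ⊢
    have hbp : b p ≠ 0 := hb p (Finset.mem_insert_self _ _)
    by_cases hc0 : c = 0
    · subst hc0
      simp only [zero_mul, zero_add] at hu0 ⊢
      obtain ⟨i, hi, h⟩ := ih hv hu0
      exact ⟨i, Finset.mem_insert_of_mem hi, h⟩
    have hdeg : m.degree (c * b p) = m.degree c + m.degree (b p) := m.degree_mul hc0 hbp
    by_cases hv0 : v = 0
    · refine ⟨p, Finset.mem_insert_self _ _, ?_⟩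
      rw [hv0, add_zero, hdeg]
      exact le_add_self
    obtain ⟨i, hi, hiv⟩ := ih hv hv0
    have hne : m.degree (c * b p) ≠ m.degree v := by
      intro h
      rw [← h, hdeg] at hiv
      refine hred _ (m.degree_mem_support hc0) i hi
        (Finsupp.le_of_le_add_of_disjoint (hd ?_ ?_ ?_) hiv)
      · simp [hi]
      · simp
      · rintro rfl; exact hp hi
    have hsup := m.degree_add_of_ne hne
    rcases le_total (m.toSyn (m.degree (c * b p))) (m.toSyn (m.degree v)) with h | h
    · rw [sup_eq_right.mpr h] at hsup
      refine ⟨i, Finset.mem_insert_of_mem hi, ?_⟩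
      rwa [m.toSyn.injective hsup]
    · rw [sup_eq_left.mpr h] at hsup
      refine ⟨p, Finset.mem_insert_self _ _, ?_⟩
      rw [m.toSyn.injective hsup, hdeg]
      exact le_add_self

theorem mem_span_range_of_mul_mem [Finite ι] (hb : ∀ i, b i ≠ 0)
    (hd : Pairwise fun i j => Disjoint (m.degree (b i)).support (m.degree (b j)).support)
    {t : MvPolynomial σ k} (ht : t ≠ 0)
    (htd : ∀ i, Disjoint (m.degree (b i)).support (m.degree t).support)
    {u : MvPolynomial σ k} (hu : t * u ∈ Ideal.span (Set.range b)) :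
    u ∈ Ideal.span (Set.range b) := by
  have := Fintype.ofFinite ι
  obtain ⟨r, hr, hred⟩ := m.exists_reduced_sub_mem_span (b := b) Set.univ (fun i _ => hb i) u
  rw [Set.image_univ] at hr
  by_cases hr0 : r = 0
  · simpa [hr0] using hr
  have htr : t * r ∈ Ideal.span (b '' (Finset.univ : Finset ι)) := by
    rw [Finset.coe_univ, Set.image_univ]
    have := sub_mem hu (Ideal.mul_mem_left _ t hr)
    rwa [← mul_sub, sub_sub_cancel] at this
  obtain ⟨i, -, hi⟩ := m.exists_degree_le_of_mem_span _ (fun i _ => hb i)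
    (fun i _ j _ h => hd h) htr (mul_ne_zero ht hr0)
  rw [m.degree_mul ht hr0, add_comm] at hi
  exact (hred _ (m.degree_mem_support hr0) i trivial
    (Finsupp.le_of_le_add_of_disjoint (htd i) hi)).elim

theorem exists_weight_le.{u} {σ : Type u} [Finite σ] (w : σ → ℕ) : ∃ m : MonomialOrder.{_, u} σ,
    ∀ c d : σ →₀ ℕ, Finsupp.weight w c < Finsupp.weight w d → m.toSyn c < m.toSyn d := by
  have := Fintype.ofFinite σ
  let _ : LinearOrder σ := LinearOrder.lift' (Fintype.equivFin σ) (Fintype.equivFin σ).injective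
  let φ : (σ →₀ ℕ) →+ ℕ ×ₗ Lex (σ →₀ ℕ) :=
    { toFun := fun c => toLex (Finsupp.weight w c, toLex c)
      map_zero' := by simp
      map_add' := fun c d => by simp; rfl }
  have hφ : ∀ c d, φ c < φ d ↔ Finsupp.weight w c < Finsupp.weight w d ∨
      Finsupp.weight w c = Finsupp.weight w d ∧ toLex c < toLex d := fun c d => by
    simp [φ, Prod.Lex.toLex_lt_toLex]
  let m : MonomialOrder σ :=
    { syn := AddMonoidHom.mrange φ
      toSyn := AddEquiv.ofLeftInverse' φ (g := fun x => ofLex (ofLex x).2) fun c => rfl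
      toSyn_monotone := by
        intro c d h
        obtain ⟨e, rfl⟩ := le_iff_exists_add.mp h
        change φ c ≤ φ (c + e)
        rw [map_add]
        refine le_add_of_nonneg_right ?_
        have he : toLex (0 : σ →₀ ℕ) ≤ toLex e := Finsupp.toLex_monotone (by simp)
        rcases Nat.eq_zero_or_pos (Finsupp.weight w e) with h0 | h0
        · exact Prod.Lex.toLex_le_toLex.mpr (Or.inr ⟨h0.symm, he⟩)
        · exact Prod.Lex.toLex_le_toLex.mpr (Or.inl h0)
      wellFoundedLT_syn := inferInstance }
  exact ⟨m, fun c d h => (hφ c d).mpr (Or.inl h)⟩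

end MonomialOrder

section GenericProduct

variable {k : Type*} [Field k] {a f g : ℕ}

/-- The exponent of the `l`-th term of the `(i,j)` entry of the generic product. -/
noncomputable def genericProdExponent (i : Fin a) (l : Fin f) (j : Fin g) :
    (Fin a × Fin f) ⊕ (Fin f × Fin g) →₀ ℕ :=
  Finsupp.single (Sum.inl (i, l)) 1 + Finsupp.single (Sum.inr (l, j)) 1

theorem genericProdEntry_eq_sum_monomial (i : Fin a) (j : Fin g) :
    genericProdEntry k a f g i j = ∑ l, monomial (genericProdExponent i l j) 1 := by
  simp [genericProdEntry, genericProdExponent, X, monomial_mul]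

theorem genericProdExponent_support (i : Fin a) (l : Fin f) (j : Fin g) :
    (genericProdExponent i l j).support = {Sum.inl (i, l), Sum.inr (l, j)} := by
  ext (⟨i', l'⟩ | ⟨l', j'⟩) <;>
    simp [genericProdExponent, Finsupp.single_apply, eq_comm]

theorem genericProdExponent_injective (i : Fin a) (j : Fin g) :
    Function.Injective fun l : Fin f => genericProdExponent i l j := by
  intro l l' h
  have h' := congrArg Finsupp.support h
  simp only [genericProdExponent_support] at h'
  have : (Sum.inl (i, l) : (Fin a × Fin f) ⊕ (Fin f × Fin g)) ∈
    ({Sum.inl (i, l'), Sum.inr (l', j)} : Finset _) := h' ▸ by simp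
  simpa using this

/-- A weight for which the `(i,j)` entry of the generic product has a unique term of
largest weight, namely `x_{i,i+j+1} y_{i+j+1,j}`. -/
def genericProdWeight (a f g : ℕ) : (Fin a × Fin f) ⊕ (Fin f × Fin g) → ℕ :=
  Sum.elim (fun p => 2 * (p.1 + 1) * p.2 + (f ^ 2 - p.2 ^ 2)) (fun p => 2 * p.2 * p.1)

theorem weight_genericProdExponent (i : Fin a) (l : Fin f) (j : Fin g) :
    (Finsupp.weight (genericProdWeight a f g) (genericProdExponent i l j) : ℤ) =
      f ^ 2 + (i + j + 1) ^ 2 - (l - (i + j + 1)) ^ 2 := by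
  have : (l : ℕ) ^ 2 ≤ f ^ 2 := Nat.pow_le_pow_left l.2.le 2
  simp only [genericProdExponent, map_add, Finsupp.weight_single, genericProdWeight]
  push_cast [this]
  simp
  push_cast [this]
  ring

theorem exists_monomialOrder_degree_genericProdEntry (k : Type*) [Field k]
    (hf : a + g ≤ f) :
    ∃ m : MonomialOrder.{_, 0} ((Fin a × Fin f) ⊕ (Fin f × Fin g)), ∀ (i : Fin a) (j : Fin g),
      genericProdEntry k a f g i j ≠ 0 ∧ m.degree (genericProdEntry k a f g i j) =
        genericProdExponent i ⟨i + j + 1, by omega⟩ j := by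
  obtain ⟨m, hm⟩ := MonomialOrder.exists_weight_le (genericProdWeight a f g)
  refine ⟨m, fun i j => ?_⟩
  set l₀ : Fin f := ⟨i + j + 1, by omega⟩ with hl₀
  have hlt : ∀ l, l ≠ l₀ →
      m.toSyn (genericProdExponent i l j) < m.toSyn (genericProdExponent i l₀ j) := by
    intro l hl
    apply hm
    zify
    rw [weight_genericProdExponent, weight_genericProdExponent]
    have : (l : ℤ) - (i + j + 1) ≠ 0 := by
      intro h
      apply hl
      ext
      simp only [hl₀]
      omega
    have := sq_pos_of_ne_zero this
    simp only [hl₀]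
    push_cast
    linarith
  have hmem : genericProdExponent i l₀ j ∈ (genericProdEntry k a f g i j).support := by
    rw [mem_support_iff, genericProdEntry_eq_sum_monomial, coeff_sum,
      Finset.sum_eq_single l₀]
    · simp
    · intro l _ hl
      rw [coeff_monomial, if_neg fun h => hl (genericProdExponent_injective i j h)]
    · simp
  refine ⟨fun h => by simp [h] at hmem, m.toSyn.injective (le_antisymm ?_ (m.le_degree hmem))⟩
  rw [m.degree_le_iff]
  intro c hc
  rw [genericProdEntry_eq_sum_monomial] at hc
  obtain ⟨l, -, hl⟩ := Finset.mem_biUnion.mp (support_sum hc)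
  obtain rfl := Finset.mem_singleton.mp (support_monomial_subset hl)
  by_cases h : l = l₀
  · rw [h]
  · exact (hlt l h).le

theorem genericComplexIdeal_eq_span_range (k : Type*) [CommSemiring k] :
    genericComplexIdeal k a f g = Ideal.span
      (Set.range fun p : Fin a × Fin g => genericProdEntry k a f g p.1 p.2) := by
  rw [genericComplexIdeal]
  congr 1
  ext P
  simp [eq_comm]

theorem disjoint_genericProdExponent_support {i i' : Fin a} {l l' : Fin f} {j j' : Fin g}
    (hl : (l : ℕ) = i + j + 1) (hl' : (l' : ℕ) = i' + j' + 1) (h : (i, j) ≠ (i', j')) :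
    Disjoint (genericProdExponent i l j).support (genericProdExponent i' l' j').support := by
  simp only [ne_eq, Prod.mk.injEq, Fin.ext_iff] at h
  simp [genericProdExponent_support, Fin.ext_iff]
  omega

theorem disjoint_genericProdExponent_support_X
    {v : (Fin a × Fin f) ⊕ (Fin f × Fin g)}
    (hv : Sum.elim (fun p => (p.2 : ℕ)) (fun p => (p.1 : ℕ)) v = 0)
    {i : Fin a} {l : Fin f} {j : Fin g} (hl : (l : ℕ) = i + j + 1) :
    Disjoint (genericProdExponent i l j).support
      (Finsupp.single v 1 : (Fin a × Fin f) ⊕ (Fin f × Fin g) →₀ ℕ).support := by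
  rw [genericProdExponent_support, Finsupp.support_single _ one_ne_zero]
  rcases v with ⟨i', l'⟩ | ⟨l', j'⟩ <;> simp [Fin.ext_iff] at hv ⊢ <;> omega

theorem mem_genericComplexIdeal_of_X_mul_mem (hf : a + g ≤ f)
    {v : (Fin a × Fin f) ⊕ (Fin f × Fin g)}
    (hv : Sum.elim (fun p => (p.2 : ℕ)) (fun p => (p.1 : ℕ)) v = 0)
    {u : MvPolynomial ((Fin a × Fin f) ⊕ (Fin f × Fin g)) k}
    (hu : X v * u ∈ genericComplexIdeal k a f g) : u ∈ genericComplexIdeal k a f g := by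
  obtain ⟨m, hm⟩ := exists_monomialOrder_degree_genericProdEntry k hf
  rw [genericComplexIdeal_eq_span_range] at hu ⊢
  refine m.mem_span_range_of_mul_mem
    (b := fun p : Fin a × Fin g => genericProdEntry k a f g p.1 p.2) (fun p => (hm p.1 p.2).1) ?_ (X_ne_zero v) ?_ hu
  · intro p q hpq
    simp only [hm]
    exact disjoint_genericProdExponent_support rfl rfl hpq
  · intro p
    rw [(hm _ _).2, m.degree_X]
    exact disjoint_genericProdExponent_support_X hv rfl

theorem mem_genericComplexIdeal_sup_of_X_mul_mem (hf : a + g ≤ f)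
    {v w : (Fin a × Fin f) ⊕ (Fin f × Fin g)} (hvw : v ≠ w)
    (hv : Sum.elim (fun p => (p.2 : ℕ)) (fun p => (p.1 : ℕ)) v = 0)
    (hw : Sum.elim (fun p => (p.2 : ℕ)) (fun p => (p.1 : ℕ)) w = 0)
    {u : MvPolynomial ((Fin a × Fin f) ⊕ (Fin f × Fin g)) k}
    (hu : X v * u ∈ genericComplexIdeal k a f g ⊔ Ideal.span {X w}) :
    u ∈ genericComplexIdeal k a f g ⊔ Ideal.span {X w} := by
  obtain ⟨m, hm⟩ := exists_monomialOrder_degree_genericProdEntry k hf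
  let b : Option (Fin a × Fin g) → MvPolynomial ((Fin a × Fin f) ⊕ (Fin f × Fin g)) k :=
    fun o => o.elim (X w) fun p => genericProdEntry k a f g p.1 p.2
  have hb : genericComplexIdeal k a f g ⊔ Ideal.span {X w} = Ideal.span (Set.range b) := by
    rw [genericComplexIdeal_eq_span_range, ← Ideal.span_union, Set.union_comm]
    congr 1
    ext P
    simp [b, Option.exists, eq_comm]
  rw [hb] at hu ⊢
  refine m.mem_span_range_of_mul_mem ?_ ?_ (X_ne_zero v) ?_ hu
  · rintro (_ | p)
    · exact X_ne_zero w
    · exact (hm p.1 p.2).1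
  · rintro (_ | p) (_ | q) hpq
    · exact (hpq rfl).elim
    · simp only [b, Option.elim, hm, m.degree_X]
      exact (disjoint_genericProdExponent_support_X hw rfl).symm
    · simp only [b, Option.elim, hm, m.degree_X]
      exact disjoint_genericProdExponent_support_X hw rfl
    · simp only [b, Option.elim, hm]
      exact disjoint_genericProdExponent_support rfl rfl fun h => hpq (congrArg some h)
  · rintro (_ | p)
    · simp only [b, Option.elim, m.degree_X, Finsupp.support_single _ one_ne_zero]
      simpa using hvw.symm
    · simp only [b, Option.elim, hm, m.degree_X]
      exact disjoint_genericProdExponent_support_X hv rfl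

end GenericProduct

theorem MvPolynomial.isIntegrallyClosed {σ : Type*} [Finite σ] {R : Type*} [CommRing R]
    [IsDomain R] [IsIntegrallyClosed R] : IsIntegrallyClosed (MvPolynomial σ R) := by
  induction σ using Finite.induction_empty_option with
  | of_equiv e h => exact .of_equiv (renameEquiv R e).toRingEquiv
  | h_empty => exact .of_equiv (isEmptyRingEquiv R PEmpty).symm
  | h_option h => exact .of_equiv (optionEquivLeft R _).symm.toRingEquiv

theorem IsLocalization.Away.isDomain_isIntegrallyClosed {R S : Type*} [CommRing R] [CommRing S]
    [Algebra R S] [IsDomain R] [IsIntegrallyClosed R] (x : R) (hx : x ≠ 0)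
    [IsLocalization.Away x S] : IsDomain S ∧ IsIntegrallyClosed S := by
  have h : Submonoid.powers x ≤ nonZeroDivisors R := powers_le_nonZeroDivisors_of_noZeroDivisors hx
  exact ⟨IsLocalization.isDomain_of_le_nonZeroDivisors S h,
    isIntegrallyClosed_of_isLocalization S _ h⟩

theorem exists_pow_mul_eq_algebraMap_of_isIntegral {S : Type*} (L K : Type*) [CommRing S]
    [CommRing L] [Field K] [Algebra S L] [Algebra S K] [IsDomain S] [IsFractionRing S K]
    (z : S) (hz : z ≠ 0) [IsLocalization.Away z L] [IsDomain L] [IsIntegrallyClosed L]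
    {x : K} (hx : IsIntegral S x) :
    ∃ (n : ℕ) (u : S), algebraMap S K (z ^ n) * x = algebraMap S K u := by
  have hle : Submonoid.powers z ≤ nonZeroDivisors S :=
    powers_le_nonZeroDivisors_of_noZeroDivisors hz
  have hunit : ∀ y : Submonoid.powers z, IsUnit (algebraMap S K y) := fun y =>
    IsLocalization.map_units K ⟨(y : S), hle y.2⟩
  let h : L →+* K := IsLocalization.lift hunit
  let _ := h.toAlgebra
  have : IsScalarTower S L K :=
    IsScalarTower.of_algebraMap_eq' (IsLocalization.lift_comp hunit).symm
  have := IsFractionRing.isFractionRing_of_isDomain_of_isLocalization (Submonoid.powers z) L K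
  obtain ⟨y, rfl⟩ := IsIntegrallyClosed.isIntegral_iff.mp (hx.tower_top (A := L))
  obtain ⟨⟨u, _, n, rfl⟩, hu⟩ := IsLocalization.surj (Submonoid.powers z) y
  refine ⟨n, u, ?_⟩
  rw [IsScalarTower.algebraMap_apply S L, IsScalarTower.algebraMap_apply S L _ u, ← hu, map_mul,
    mul_comm]

theorem isDomain_isIntegrallyClosed_of_away {S : Type*} [CommRing S] (s t : S)
    (hs : s ∈ nonZeroDivisors S) (ht : t ∈ nonZeroDivisors S)
    (hst : ∀ u, s ∣ t * u → s ∣ u)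
    (h1 : IsDomain (Localization.Away s) ∧ IsIntegrallyClosed (Localization.Away s))
    (h2 : IsDomain (Localization.Away t) ∧ IsIntegrallyClosed (Localization.Away t)) :
    IsDomain S ∧ IsIntegrallyClosed S := by
  obtain ⟨_, _⟩ := h1
  obtain ⟨_, _⟩ := h2
  have hdom : IsDomain S :=
    (IsLocalization.injective (Localization.Away s) (Submonoid.powers_le.mpr hs)).isDomain
      (algebraMap S (Localization.Away s))
  have hs0 : s ≠ 0 := nonZeroDivisors.ne_zero hs
  have ht0 : t ≠ 0 := nonZeroDivisors.ne_zero ht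
  refine ⟨hdom, (isIntegrallyClosed_iff (FractionRing S)).mpr fun {x} hx => ?_⟩
  obtain ⟨n, u, hu⟩ := exists_pow_mul_eq_algebraMap_of_isIntegral (Localization.Away s) _ s hs0 hx
  obtain ⟨m, v, hv⟩ := exists_pow_mul_eq_algebraMap_of_isIntegral (Localization.Away t) _ t ht0 hx
  have huv : t ^ m * u = s ^ n * v := by
    apply IsFractionRing.injective S (FractionRing S)
    rw [map_mul, map_mul, ← hu, ← hv]
    ring
  have hstm : ∀ (m : ℕ) (u : S), s ∣ t ^ m * u → s ∣ u := by
    intro m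
    induction m with
    | zero => simp
    | succ m ih =>
      intro u h
      rw [pow_succ, mul_assoc] at h
      exact hst _ (ih _ h)
  have hdvd : ∀ (n : ℕ) (u v : S), t ^ m * u = s ^ n * v → s ^ n ∣ u := by
    intro n
    induction n with
    | zero => simp
    | succ n ih =>
      intro u v h
      obtain ⟨u', rfl⟩ := hstm m u ⟨s ^ n * v, by rw [h]; ring⟩
      have := ih u' v (mul_left_cancel₀ hs0 (by linear_combination h))
      rw [pow_succ']
      exact mul_dvd_mul_left s this
  obtain ⟨y, rfl⟩ := hdvd n u v huv
  refine ⟨y, ?_⟩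
  rw [map_mul] at hu
  refine (mul_left_cancel₀ ?_ hu).symm
  rw [ne_eq, FaithfulSMul.algebraMap_eq_zero_iff]
  exact pow_ne_zero n hs0

section Elimination

/-- The coordinate ring of the variety of complexes. -/
abbrev GenericComplexRing (k : Type*) [CommRing k] (a f g : ℕ) : Type _ :=
  MvPolynomial ((Fin a × Fin f) ⊕ (Fin f × Fin g)) k ⧸ genericComplexIdeal k a f g

namespace GenericComplexRing

variable (k : Type*) [CommRing k] {a f g : ℕ}

/-- The class of the variable `x_{il}`. -/
noncomputable def x (i : Fin a) (l : Fin f) : GenericComplexRing k a f g :=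
  Ideal.Quotient.mk _ (X (Sum.inl (i, l)))

/-- The class of the variable `y_{lj}`. -/
noncomputable def y (l : Fin f) (j : Fin g) : GenericComplexRing k a f g :=
  Ideal.Quotient.mk _ (X (Sum.inr (l, j)))

theorem sum_x_mul_y (i : Fin a) (j : Fin g) :
    ∑ l : Fin f, (x k i l : GenericComplexRing k a f g) * y k l j = 0 := by
  have h : genericProdEntry k a f g i j ∈ genericComplexIdeal k a f g :=
    Ideal.subset_span ⟨i, j, rfl⟩
  simpa [genericProdEntry, x, y] using Ideal.Quotient.eq_zero_iff_mem.mpr h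

variable {k} {B : Type*} [CommRing B] [Algebra k B]

theorem exists_algHom (M : Fin a → Fin f → B) (N : Fin f → Fin g → B)
    (h : ∀ i j, ∑ l, M i l * N l j = 0) :
    ∃ F : GenericComplexRing k a f g →ₐ[k] B,
      (∀ i l, F (x k i l) = M i l) ∧ ∀ l j, F (y k l j) = N l j := by
  let F₀ : MvPolynomial ((Fin a × Fin f) ⊕ (Fin f × Fin g)) k →ₐ[k] B :=
    aeval (Sum.elim (fun p => M p.1 p.2) fun p => N p.1 p.2)
  have hle : genericComplexIdeal k a f g ≤ RingHom.ker F₀ := by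
    rw [genericComplexIdeal, Ideal.span_le]
    rintro _ ⟨i, j, rfl⟩
    simp [F₀, genericProdEntry, RingHom.mem_ker, h]
  refine ⟨Ideal.Quotient.liftₐ _ F₀ hle, fun i l => ?_, fun l j => ?_⟩
  · exact (Ideal.Quotient.lift_mk _ _ _).trans (by simp [F₀])
  · exact (Ideal.Quotient.lift_mk _ _ _).trans (by simp [F₀])

theorem algHom_ext {F G : GenericComplexRing k a f g →ₐ[k] B}
    (hx : ∀ i l, F (x k i l) = G (x k i l)) (hy : ∀ l j, F (y k l j) = G (y k l j)) : F = G := by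
  refine Ideal.Quotient.algHom_ext _ (MvPolynomial.algHom_ext ?_)
  rintro (⟨i, l⟩ | ⟨l, j⟩)
  · exact hx i l
  · exact hy l j

theorem exists_transpose_equiv (a f g : ℕ) :
    ∃ e : GenericComplexRing k a f g ≃ₐ[k] GenericComplexRing k g f a,
      ∀ l j, e (y k l j) = x k j l := by
  have h : ∀ a g : ℕ, ∃ F : GenericComplexRing k a f g →ₐ[k] GenericComplexRing k g f a,
      (∀ i l, F (x k i l) = y k l i) ∧ ∀ l j, F (y k l j) = x k j l := fun a g =>
    exists_algHom _ _ fun i j => by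
      simp_rw [mul_comm]
      exact sum_x_mul_y k j i
  obtain ⟨F, hFx, hFy⟩ := h a g
  obtain ⟨G, hGx, hGy⟩ := h g a
  exact ⟨AlgEquiv.ofAlgHom F G (algHom_ext (by simp [*]) (by simp [*]))
    (algHom_ext (by simp [*]) (by simp [*])), hFy⟩

end GenericComplexRing

theorem IsLocalization.Away.exists_algHom {k R B : Type*} [CommRing k] [CommRing R] [CommRing B]
    [Algebra k R] [Algebra k B] (z : R) (L : Type*) [CommRing L] [Algebra R L] [Algebra k L]
    [IsScalarTower k R L] [IsLocalization.Away z L] (h : R →ₐ[k] B) (hz : IsUnit (h z)) :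
    ∃ F : L →ₐ[k] B, ∀ r, F (algebraMap R L r) = h r := by
  refine ⟨IsLocalization.liftAlgHom (M := Submonoid.powers z) (f := h) ?_, fun r => ?_⟩
  · rintro ⟨_, n, rfl⟩
    simpa using hz.pow n
  · exact IsLocalization.lift_eq _ r

namespace GenericComplexRing

variable {k : Type*} [CommRing k] {a f g : ℕ}

/-- Inverting `x_{00}` eliminates the first row and column of `X` and the first row of `Y`. -/
theorem nonempty_algEquiv_away (L Q : Type*) [CommRing L] [CommRing Q]
    [Algebra (GenericComplexRing k (a + 1) (f + 1) g) L] [Algebra k L]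
    [IsScalarTower k (GenericComplexRing k (a + 1) (f + 1) g) L]
    [IsLocalization.Away (x k 0 0 : GenericComplexRing k (a + 1) (f + 1) g) L]
    [Algebra (MvPolynomial (Option (Fin f ⊕ Fin a)) (GenericComplexRing k a f g)) Q] [Algebra k Q]
    [IsScalarTower k (MvPolynomial (Option (Fin f ⊕ Fin a)) (GenericComplexRing k a f g)) Q]
    [IsLocalization.Away
      (X none : MvPolynomial (Option (Fin f ⊕ Fin a)) (GenericComplexRing k a f g)) Q] :
    Nonempty (L ≃ₐ[k] Q) := by
  let π := IsScalarTower.toAlgHom k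
    (MvPolynomial (Option (Fin f ⊕ Fin a)) (GenericComplexRing k a f g)) Q
  let ι := π.comp (IsScalarTower.toAlgHom k (GenericComplexRing k a f g) _)
  let κ := IsScalarTower.toAlgHom k (GenericComplexRing k (a + 1) (f + 1) g) L
  obtain ⟨u, hu⟩ : IsUnit (π (X none)) :=
    IsLocalization.map_units Q (⟨_, Submonoid.mem_powers (X none)⟩)
  obtain ⟨v, hv⟩ : IsUnit (κ (x k 0 0)) :=
    IsLocalization.map_units L (⟨_, Submonoid.mem_powers (x k 0 0)⟩)
  have hι : ∀ i j, ∑ l, ι (x k i l) * ι (y k l j) = 0 := fun i j => by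
    simpa only [map_sum, map_mul, map_zero] using congrArg ι (sum_x_mul_y k i j)
  have hκ : ∀ i j, κ (x k i 0) * κ (y k 0 j) +
      ∑ l : Fin f, κ (x k i l.succ) * κ (y k l.succ j) = 0 := fun i j => by
    simpa only [map_sum, map_add, map_mul, map_zero, Fin.sum_univ_succ] using
      congrArg κ (sum_x_mul_y k i j)
  obtain ⟨φ₀, hφx, hφy⟩ := exists_algHom (k := k) (B := Q)
    (Fin.cons (Fin.cons (u : Q) fun l => π (X (some (Sum.inl l)))) fun i =>
      Fin.cons (π (X (some (Sum.inr i)))) fun l =>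
        ι (x k i l) + ↑u⁻¹ * π (X (some (Sum.inr i))) * π (X (some (Sum.inl l))))
    (Fin.cons (fun j => - ↑u⁻¹ * ∑ l, π (X (some (Sum.inl l))) * ι (y k l j))
      fun l j => ι (y k l j)) (by
        intro i j
        rw [Fin.sum_univ_succ]
        refine Fin.cases ?_ (fun i => ?_) i
        · simp
        · simp only [Fin.cons_zero, Fin.cons_succ, add_mul, Finset.sum_add_distrib, hι,
            zero_add]
          rw [Finset.mul_sum, Finset.mul_sum, ← Finset.sum_add_distrib]
          exact Finset.sum_eq_zero fun l _ => by ring)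
  obtain ⟨φ, hφ⟩ := IsLocalization.Away.exists_algHom (x k 0 0) L φ₀ (by
    rw [hφx]; exact u.isUnit)
  obtain ⟨ψ₀, hψx, hψy⟩ := exists_algHom (k := k) (B := L)
    (fun (i : Fin a) (l : Fin f) => κ (x k i.succ l.succ) -
      ↑v⁻¹ * κ (x k i.succ 0) * κ (x k 0 l.succ))
    (fun l (j : Fin g) => κ (y k l.succ j)) (by
      intro i j
      simp only [sub_mul, Finset.sum_sub_distrib, mul_assoc, ← Finset.mul_sum]
      have h0 := hκ 0 j
      rw [← hv] at h0
      linear_combination hκ i.succ j - ↑v⁻¹ * κ (x k i.succ 0) * h0 +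
        κ (x k i.succ 0) * κ (y k 0 j) * v.inv_mul)
  obtain ⟨ψ, hψ⟩ := IsLocalization.Away.exists_algHom (k := k)
    (R := MvPolynomial (Option (Fin f ⊕ Fin a)) (GenericComplexRing k a f g)) (X none) Q
    (aevalTower ψ₀ (Option.elim · (v : L)
      (Sum.elim (fun l : Fin f => κ (x k 0 l.succ)) fun i : Fin a => κ (x k i.succ 0))))
    (by rw [aevalTower_X]; exact v.isUnit)
  replace hφ : ∀ r, φ (κ r) = φ₀ r := hφ
  replace hψ : ∀ r, ψ (π r) = _ := hψ
  have hψι : ∀ r, ψ (ι r) = ψ₀ r := fun r => (hψ _).trans (aevalTower_C _ _ _)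
  have hφv : φ ↑v⁻¹ = ↑u⁻¹ := by
    have : φ v = u := by rw [hv, hφ, hφx]; rfl
    exact Units.eq_inv_of_mul_eq_one_left (by rw [← this, ← map_mul, v.mul_inv, map_one])
  have hψu : ψ ↑u⁻¹ = ↑v⁻¹ := by
    have : ψ u = v := by rw [hu, hψ]; simp
    exact Units.eq_inv_of_mul_eq_one_left (by rw [← this, ← map_mul, u.mul_inv, map_one])
  refine ⟨AlgEquiv.ofAlgHom φ ψ ?_ ?_⟩
  · apply IsLocalization.algHom_ext (Submonoid.powers
      (X none : MvPolynomial (Option (Fin f ⊕ Fin a)) (GenericComplexRing k a f g)))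
    refine MvPolynomial.algHom_ext' (algHom_ext (fun i l => ?_) fun l j => ?_) ?_
    · change φ (ψ (ι _)) = ι _
      rw [hψι, hψx]
      simp only [map_sub, map_mul, hφ, hφx, hφv]
      simp
    · change φ (ψ (ι _)) = ι _
      rw [hψι, hψy, hφ, hφy]
      simp
    · rintro (_ | l | i)
      · change φ (ψ (π _)) = π _
        rw [hψ]
        simp [hv, hφ, hφx, hu]
      · change φ (ψ (π _)) = π _
        rw [hψ]
        simp [hφ, hφx]
      · change φ (ψ (π _)) = π _
        rw [hψ]
        simp [hφ, hφx]
  · apply IsLocalization.algHom_ext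
      (Submonoid.powers (x k 0 0 : GenericComplexRing k (a + 1) (f + 1) g))
    refine algHom_ext (fun i l => ?_) fun l j => ?_
    · change ψ (φ (κ _)) = κ _
      rw [hφ, hφx]
      refine Fin.cases (Fin.cases ?_ (fun l => ?_) l) (fun i => Fin.cases ?_ (fun l => ?_) l) i
      · simp [hu, hψ, hv]
      · simp [hψ]
      · simp [hψ]
      · simp [hψ, hψι, hψx, hψu]
    · change ψ (φ (κ _)) = κ _
      rw [hφ, hφy]
      refine Fin.cases ?_ (fun l => ?_) l
      · have h0 := hκ 0 j
        rw [← hv] at h0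
        simp only [Fin.cons_zero, map_mul, map_neg, map_sum, hψ, hψι, hψy, hψu, aevalTower_X,
          Option.elim, Sum.elim_inl]
        linear_combination -↑v⁻¹ * h0 + κ (y k 0 j) * v.inv_mul
      · simp [hψι, hψy]

end GenericComplexRing

end Elimination

section Normality

namespace GenericComplexRing

variable {k : Type*} [Field k] {a f g : ℕ}

theorem x_mem_nonZeroDivisors (hf : a + 1 + (g + 1) ≤ f + 1) :
    (x k 0 0 : GenericComplexRing k (a + 1) (f + 1) (g + 1)) ∈ nonZeroDivisors _ := by
  rw [mem_nonZeroDivisors_iff_right]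
  intro u hu
  obtain ⟨u, rfl⟩ := Ideal.Quotient.mk_surjective u
  rw [mul_comm, x, ← map_mul, Ideal.Quotient.eq_zero_iff_mem] at hu
  exact Ideal.Quotient.eq_zero_iff_mem.mpr (mem_genericComplexIdeal_of_X_mul_mem hf (by simp) hu)

theorem y_mem_nonZeroDivisors (hf : a + 1 + (g + 1) ≤ f + 1) :
    (y k 0 0 : GenericComplexRing k (a + 1) (f + 1) (g + 1)) ∈ nonZeroDivisors _ := by
  rw [mem_nonZeroDivisors_iff_right]
  intro u hu
  obtain ⟨u, rfl⟩ := Ideal.Quotient.mk_surjective u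
  rw [mul_comm, y, ← map_mul, Ideal.Quotient.eq_zero_iff_mem] at hu
  exact Ideal.Quotient.eq_zero_iff_mem.mpr (mem_genericComplexIdeal_of_X_mul_mem hf (by simp) hu)

theorem mk_X_dvd_mk_iff {v : (Fin a × Fin f) ⊕ (Fin f × Fin g)}
    {u : MvPolynomial ((Fin a × Fin f) ⊕ (Fin f × Fin g)) k} :
    Ideal.Quotient.mk (genericComplexIdeal k a f g) (X v) ∣ Ideal.Quotient.mk _ u ↔
      u ∈ genericComplexIdeal k a f g ⊔ Ideal.span {X v} := by
  rw [← Ideal.mem_span_singleton, ← Set.image_singleton, ← Ideal.map_span,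
    Ideal.mem_quotient_iff_mem_sup, sup_comm]

theorem x_dvd_of_dvd_y_mul (hf : a + 1 + (g + 1) ≤ f + 1)
    {u : GenericComplexRing k (a + 1) (f + 1) (g + 1)} (h : x k 0 0 ∣ y k 0 0 * u) :
    x k 0 0 ∣ u := by
  obtain ⟨u, rfl⟩ := Ideal.Quotient.mk_surjective u
  rw [x, y, ← map_mul, mk_X_dvd_mk_iff] at h
  exact mk_X_dvd_mk_iff.mpr
    (mem_genericComplexIdeal_sup_of_X_mul_mem hf (by simp) (by simp) (by simp) h)

theorem isDomain_isIntegrallyClosed_away_x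
    (h : IsDomain (GenericComplexRing k a f g) ∧ IsIntegrallyClosed (GenericComplexRing k a f g)) :
    IsDomain (Localization.Away (x k 0 0 : GenericComplexRing k (a + 1) (f + 1) g)) ∧
      IsIntegrallyClosed
        (Localization.Away (x k 0 0 : GenericComplexRing k (a + 1) (f + 1) g)) := by
  obtain ⟨_, _⟩ := h
  let P := MvPolynomial (Option (Fin f ⊕ Fin a)) (GenericComplexRing k a f g)
  have : IsIntegrallyClosed P := MvPolynomial.isIntegrallyClosed
  obtain ⟨_, _⟩ := IsLocalization.Away.isDomain_isIntegrallyClosed (R := P)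
    (S := Localization.Away (X none : P)) (X none) (X_ne_zero _)
  obtain ⟨e⟩ := nonempty_algEquiv_away (k := k) (a := a) (f := f) (g := g)
    (Localization.Away (x k 0 0 : GenericComplexRing k (a + 1) (f + 1) g))
    (Localization.Away (X none : P))
  exact ⟨e.toMulEquiv.isDomain, .of_equiv e.symm.toRingEquiv⟩

theorem isDomain_isIntegrallyClosed_away_y
    (h : IsDomain (GenericComplexRing k g f a) ∧ IsIntegrallyClosed (GenericComplexRing k g f a)) :
    IsDomain (Localization.Away (y k 0 0 : GenericComplexRing k a (f + 1) (g + 1))) ∧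
      IsIntegrallyClosed
        (Localization.Away (y k 0 0 : GenericComplexRing k a (f + 1) (g + 1))) := by
  obtain ⟨_, _⟩ := isDomain_isIntegrallyClosed_away_x h
  obtain ⟨e, he⟩ := exists_transpose_equiv (k := k) a (f + 1) (g + 1)
  let e' : Localization.Away (y k 0 0 : GenericComplexRing k a (f + 1) (g + 1)) ≃+*
      Localization.Away (x k 0 0 : GenericComplexRing k (g + 1) (f + 1) a) :=
    IsLocalization.ringEquivOfRingEquiv (M := Submonoid.powers (y k 0 0))
      (T := Submonoid.powers (x k 0 0)) _ _ e.toRingEquiv (by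
        rw [Submonoid.map_powers]
        exact congrArg _ (he 0 0))
  exact ⟨e'.toMulEquiv.isDomain, .of_equiv e'.symm⟩

theorem isDomain_isIntegrallyClosed_of_eq_bot (h : genericComplexIdeal k a f g = ⊥) :
    IsDomain (GenericComplexRing k a f g) ∧ IsIntegrallyClosed (GenericComplexRing k a f g) := by
  let e := (Ideal.quotEquivOfEq h).trans (RingEquiv.quotientBot _)
  have : IsIntegrallyClosed (MvPolynomial ((Fin a × Fin f) ⊕ (Fin f × Fin g)) k) :=
    MvPolynomial.isIntegrallyClosed
  exact ⟨e.toMulEquiv.isDomain, .of_equiv e.symm⟩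

theorem isDomain_isIntegrallyClosed (hf : a + g ≤ f) :
    IsDomain (GenericComplexRing k a f g) ∧ IsIntegrallyClosed (GenericComplexRing k a f g) := by
  induction f generalizing a g with
  | zero =>
    exact isDomain_isIntegrallyClosed_of_eq_bot
      (by simp [genericComplexIdeal, genericProdEntry])
  | succ f ih =>
    obtain _ | a := a
    · exact isDomain_isIntegrallyClosed_of_eq_bot (by simp [genericComplexIdeal])
    obtain _ | g := g
    · exact isDomain_isIntegrallyClosed_of_eq_bot (by simp [genericComplexIdeal])
    exact isDomain_isIntegrallyClosed_of_away _ _ (x_mem_nonZeroDivisors hf)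
      (y_mem_nonZeroDivisors hf) (fun _ => x_dvd_of_dvd_y_mul hf)
      (isDomain_isIntegrallyClosed_away_x (ih (by lia)))
      (isDomain_isIntegrallyClosed_away_y (ih (by lia)))

end GenericComplexRing

end Normality

/-- If `1 ≤ a ≤ f − g`, then the quotient of the polynomial ring
`R = k[x_{il}, y_{lj}]` by the ideal `I` generated by the `ag` entries of the generic
matrix product `X·Y` is an integrally closed (normal) integral domain; geometrically, the
variety of complexes `{(M, L) : M·L = 0}` is a normal, integral affine variety. -/
theorem genericComplexQuotient_isDomain_isIntegrallyClosed
    (k : Type*) [Field k] (a f g : ℕ) (ha : 0 < a) (hg : 0 < g) (hafg : a + g ≤ f) :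
    IsDomain
        (MvPolynomial ((Fin a × Fin f) ⊕ (Fin f × Fin g)) k ⧸ genericComplexIdeal k a f g) ∧
      IsIntegrallyClosed
        (MvPolynomial ((Fin a × Fin f) ⊕ (Fin f × Fin g)) k ⧸ genericComplexIdeal k a f g) :=
  GenericComplexRing.isDomain_isIntegrallyClosed hafg
end

section
/- Let k be an algebraically closed field, let f ≥ g ≥ 1 and a ≥ 1 be integers, and let Z = {(M, L) ∈ Mat_{a×f}(k) × Mat_{f×g}(k) : M·L = 0} with its Zariski topology. If a > f − g, then Z is not irreducible. Moreover, if a = f − g + 1, then Z has exactly two irreducible components, namely the Zariski closure of {(M, L) ∈ Z : rank L = g} and the closed set {(M, L) ∈ Z : rank L ≤ g − 1}, and both components have dimension fg + a(f − g). -/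
/-- The affine space of pairs of matrices `(M, L)` with `M` of size `a × f` and `L` of
size `f × g`. -/
abbrev MatPair (k : Type*) (a f g : ℕ) : Type _ :=
  Matrix (Fin a) (Fin f) k × Matrix (Fin f) (Fin g) k

/-- The coordinates of a pair of matrices, as a point of affine `(af + fg)`-space. -/
def MatPair.coords {k : Type*} {a f g : ℕ} (x : MatPair k a f g) :
    (Fin a × Fin f) ⊕ (Fin f × Fin g) → k :=
  Sum.elim (fun q => x.1 q.1 q.2) (fun q => x.2 q.1 q.2)

/-- The Zariski topology on the affine space of pairs of matrices: the topology generated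
by the complements of the zero sets of polynomials in the matrix entries.  Its closed
sets are exactly the zero loci of sets of polynomials. -/
def matPairZariski (k : Type*) [CommRing k] (a f g : ℕ) :
    TopologicalSpace (MatPair k a f g) :=
  TopologicalSpace.generateFrom
    {s | ∃ p : MvPolynomial ((Fin a × Fin f) ⊕ (Fin f × Fin g)) k,
      s = {x | MvPolynomial.eval x.coords p ≠ 0}}

/-- The Krull dimension is invariant under integral extensions. -/
theorem ringKrullDim_eq_of_isIntegral_of_faithfulSMul (R S : Type*) [CommRing R] [CommRing S]
    [Algebra R S] [Algebra.IsIntegral R S] [FaithfulSMul R S] :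
    ringKrullDim S = ringKrullDim R := by
  apply le_antisymm
  · exact Order.krullDim_le_of_strictMono (PrimeSpectrum.comap (algebraMap R S))
      fun I J hIJ => Ideal.IsIntegral.comap_lt_comap (R := R) hIJ
  · refine iSup_le fun l => ?_
    obtain ⟨Q, hQ, hQl⟩ := (Ideal.nonempty_primesOver (S := S) l.head.asIdeal).some
    obtain ⟨l', hl', -, -⟩ := Ideal.exists_ltSeries_of_hasGoingUp (S := S) l Q
    rw [← hl']
    exact Order.LTSeries.length_le_krullDim l'

/-- The Krull dimension of a finitely generated domain over a field is its transcendence degree. -/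
theorem ringKrullDim_eq_natCard_of_isTranscendenceBasis {k A σ : Type*} [Field k] [CommRing A]
    [IsDomain A] [Algebra k A] [Algebra.FiniteType k A] [Finite σ] {x : σ → A}
    (hx : IsTranscendenceBasis k x) : ringKrullDim A = Nat.card σ := by
  obtain ⟨s, φ, hφ, hint⟩ := exists_integral_inj_algHom_of_fg k A
  let _ : Algebra (MvPolynomial (Fin s) k) A := φ.toRingHom.toAlgebra
  have : IsScalarTower k (MvPolynomial (Fin s) k) A :=
    .of_algebraMap_eq fun r => (φ.commutes r).symm
  have : Algebra.IsIntegral (MvPolynomial (Fin s) k) A := ⟨hint⟩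
  have : FaithfulSMul (MvPolynomial (Fin s) k) A :=
    (faithfulSMul_iff_algebraMap_injective _ _).mpr hφ
  have htr := lift_trdeg_add_eq k (MvPolynomial (Fin s) k) A
  rw [trdeg_eq_zero (R := MvPolynomial (Fin s) k)] at htr
  have hσ : Nat.card σ = Cardinal.toNat (Algebra.trdeg k A) := by
    simpa [Nat.card] using congrArg Cardinal.toNat hx.lift_cardinalMk_eq_trdeg
  have hs : s = Cardinal.toNat (Algebra.trdeg k A) := by
    simpa using congrArg Cardinal.toNat htr
  rw [ringKrullDim_eq_of_isIntegral_of_faithfulSMul (MvPolynomial (Fin s) k) A,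
    MvPolynomial.ringKrullDim_of_isNoetherianRing, ringKrullDim_eq_zero_of_field, Nat.card_fin,
    zero_add, hσ, ← hs]

theorem isTranscendenceBasis_of_adjoin_eq_top {k A σ : Type*} [Field k] [CommRing A]
    [IsDomain A] [Algebra k A] {x : σ → A} (hx : AlgebraicIndependent k x) {t : Set A}
    (ht : Algebra.adjoin k t = ⊤)
    (halg : ∀ y ∈ t, IsAlgebraic (Algebra.adjoin k (Set.range x)) y) :
    IsTranscendenceBasis k x := by
  rw [hx.isTranscendenceBasis_iff_isAlgebraic]
  have hle : Algebra.adjoin k t ≤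
      (Subalgebra.algebraicClosure (Algebra.adjoin k (Set.range x)) A).restrictScalars k :=
    Algebra.adjoin_le halg
  exact ⟨fun y => hle (ht ▸ Algebra.mem_top)⟩

section Zariski

open MvPolynomial

variable {k ι V : Type*} [Field k] [TopologicalSpace V] {c : V → ι → k}

/-- The topology of `V` is the one induced by `c` from the Zariski topology on affine space. -/
def IsZariskiChart (c : V → ι → k) : Prop :=
  ∀ s : Set V, IsClosed s ↔ ∃ I : Ideal (MvPolynomial ι k), s = c ⁻¹' zeroLocus k I

namespace IsZariskiChart

theorem comp_subtypeVal (hc : IsZariskiChart c) (C : Set V) :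
    IsZariskiChart fun x : C => c x := by
  intro s
  rw [isClosed_induced_iff]
  constructor
  · rintro ⟨t, ht, rfl⟩
    obtain ⟨I, rfl⟩ := (hc t).1 ht
    exact ⟨I, rfl⟩
  · rintro ⟨I, rfl⟩
    exact ⟨_, (hc _).2 ⟨I, rfl⟩, rfl⟩

theorem preimage_zeroLocus_vanishingIdeal (hc : IsZariskiChart c) {s : Set V} (hs : IsClosed s) :
    c ⁻¹' zeroLocus k (vanishingIdeal k (c '' s)) = s := by
  obtain ⟨I, rfl⟩ := (hc s).1 hs
  refine Set.Subset.antisymm (fun x hx p hp => hx p ?_) fun x hx p hp => hp _ ⟨x, hx, rfl⟩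
  rintro _ ⟨y, hy, rfl⟩
  exact hy p hp

theorem isIrreducible_iff (hc : IsZariskiChart c) {s : Set V} :
    IsIrreducible s ↔ (vanishingIdeal k (c '' s)).IsPrime := by
  constructor
  · rintro ⟨⟨x, hx⟩, hs⟩
    refine ⟨fun h => ?_, fun {p q} hpq => ?_⟩
    · have h1 : (1 : MvPolynomial ι k) ∈ vanishingIdeal k (c '' s) := h ▸ Submodule.mem_top
      simpa using h1 _ ⟨x, hx, rfl⟩
    · have key := isPreirreducible_iff_isClosed_union_isClosed.1 hs
        _ _ ((hc _).2 ⟨Ideal.span {p}, rfl⟩) ((hc _).2 ⟨Ideal.span {q}, rfl⟩) ?_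
      · simpa [zeroLocus_span, Set.subset_def] using key
      · intro y hy
        have := hpq _ ⟨y, hy, rfl⟩
        simpa [zeroLocus_span] using this
  · intro hP
    refine ⟨?_, isPreirreducible_iff_isClosed_union_isClosed.2 ?_⟩
    · by_contra h
      rw [Set.not_nonempty_iff_eq_empty] at h
      exact hP.ne_top (by rw [h, Set.image_empty, vanishingIdeal_empty])
    · intro z₁ z₂ h₁ h₂ hs
      obtain ⟨I, rfl⟩ := (hc _).1 h₁
      obtain ⟨J, rfl⟩ := (hc _).1 h₂
      have hIJ : I * J ≤ vanishingIdeal k (c '' s) := by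
        rw [Ideal.mul_le]
        rintro p hp q hq _ ⟨x, hx, rfl⟩
        rcases hs hx with h | h
        · rw [map_mul, h p hp, zero_mul]
        · rw [map_mul, h q hq, mul_zero]
      rcases hP.mul_le.1 hIJ with h | h
      · exact .inl fun x hx p hp => h hp _ ⟨x, hx, rfl⟩
      · exact .inr fun x hx p hp => h hp _ ⟨x, hx, rfl⟩

/-- A set dominated by a nonempty principal open subset of an affine space is irreducible. -/
theorem isIrreducible_of_parametrization [Infinite k] (hc : IsZariskiChart c) {τ : Type*}
    (Φ : ι → MvPolynomial τ k) {q : MvPolynomial τ k} (hq : q ≠ 0) {s : Set V}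
    (hs : ∀ x ∈ s, ∃ y : τ → k, eval y q ≠ 0 ∧ c x = fun i => eval y (Φ i))
    (hs' : ∀ y : τ → k, eval y q ≠ 0 → ∃ x ∈ s, c x = fun i => eval y (Φ i)) :
    IsIrreducible s := by
  have hcomp : ∀ (y : τ → k) (p : MvPolynomial ι k),
      eval (fun i => eval y (Φ i)) p = eval y (aeval Φ p) := fun y p => by
    change _ = (RingHom.comp (eval y) (aeval Φ : MvPolynomial ι k →ₐ[k] _).toRingHom) p
    congr 1
    ext <;> simp
  rw [hc.isIrreducible_iff]
  convert RingHom.ker_isPrime (aeval Φ : MvPolynomial ι k →ₐ[k] MvPolynomial τ k) using 1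
  ext p
  rw [RingHom.mem_ker, mem_vanishingIdeal_iff]
  constructor
  · intro hp
    have h0 : aeval Φ p * q = 0 := by
      refine funext fun y => ?_
      by_cases hy : eval y q = 0
      · simp [hy]
      · obtain ⟨x, hx, hxy⟩ := hs' y hy
        have := hp _ ⟨x, hx, rfl⟩
        rw [hxy, aeval_eq_eval, hcomp] at this
        rw [map_mul, this, zero_mul, map_zero]
    exact (mul_eq_zero.1 h0).resolve_right hq
  · rintro hp _ ⟨x, hx, rfl⟩
    obtain ⟨y, -, hxy⟩ := hs x hx
    rw [hxy, aeval_eq_eval, hcomp, hp, map_zero]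

theorem topologicalKrullDim_eq_of_range_eq [IsAlgClosed k] [Finite ι] (hc : IsZariskiChart c)
    {I : Ideal (MvPolynomial ι k)} (hr : Set.range c = zeroLocus k I) :
    topologicalKrullDim V = ringKrullDim (MvPolynomial ι k ⧸ I) := by
  have himage : ∀ P : Ideal (MvPolynomial ι k), I ≤ P →
      c '' (c ⁻¹' zeroLocus k P) = zeroLocus k P := fun P hP => by
    rw [Set.image_preimage_eq_inter_range, hr]
    exact Set.inter_eq_left.2 (zeroLocus_anti_mono hP)
  have hle : ∀ s : Set V, I ≤ vanishingIdeal k (c '' s) := fun s => by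
    rw [← le_zeroLocus_iff_le_vanishingIdeal, ← hr]
    exact Set.image_subset_range _ _
  rw [ringKrullDim_quotient, topologicalKrullDim,
    ← Order.krullDim_orderDual (α := PrimeSpectrum.zeroLocus (I : Set (MvPolynomial ι k)))]
  apply le_antisymm
  · refine Order.krullDim_le_of_strictMono (fun T => OrderDual.toDual
      ⟨⟨vanishingIdeal k (c '' T), hc.isIrreducible_iff.1 T.isIrreducible⟩, hle _⟩) ?_
    refine Monotone.strictMono_of_injective (fun S T h => ?_) fun S T h => ?_
    · exact vanishingIdeal_anti_mono (Set.image_mono h)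
    · have h' : vanishingIdeal k (c '' S) = vanishingIdeal k (c '' T) :=
        congrArg (fun p => (OrderDual.ofDual p).1.asIdeal) h
      apply TopologicalSpace.IrreducibleCloseds.ext
      rw [← hc.preimage_zeroLocus_vanishingIdeal S.isClosed, h',
        hc.preimage_zeroLocus_vanishingIdeal T.isClosed]
  · refine Order.krullDim_le_of_strictMono (fun p =>
      ⟨c ⁻¹' zeroLocus k (OrderDual.ofDual p).1.asIdeal, hc.isIrreducible_iff.2 ?_,
        (hc _).2 ⟨_, rfl⟩⟩) ?_
    · have := (OrderDual.ofDual p).1.isPrime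
      rw [himage _ (OrderDual.ofDual p).2, IsPrime.vanishingIdeal_zeroLocus]
      exact this
    · refine Monotone.strictMono_of_injective (fun p q h => ?_) fun p q h => ?_
      · exact fun x hx r hr => hx r (h hr)
      · have h' := congrArg (fun T : TopologicalSpace.IrreducibleCloseds V =>
          vanishingIdeal k (c '' (T : Set V))) h
        have hp := (OrderDual.ofDual p).1.isPrime
        have hq := (OrderDual.ofDual q).1.isPrime
        change vanishingIdeal k (c '' (c ⁻¹' zeroLocus k (OrderDual.ofDual p).1.asIdeal)) =
          vanishingIdeal k (c '' (c ⁻¹' zeroLocus k (OrderDual.ofDual q).1.asIdeal)) at h'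
        rw [himage _ (OrderDual.ofDual p).2, himage _ (OrderDual.ofDual q).2,
          IsPrime.vanishingIdeal_zeroLocus, IsPrime.vanishingIdeal_zeroLocus] at h'
        exact OrderDual.ofDual.injective (Subtype.ext (PrimeSpectrum.ext h'))

/-- The dimension of an irreducible closed set which projects dominantly to the affine space on
some of the coordinates, and whose remaining coordinates are generically rational functions of
those, is the number of these coordinates. -/
theorem topologicalKrullDim_eq_natCard [IsAlgClosed k] [Finite ι] (hc : IsZariskiChart c)
    (hsurj : Function.Surjective c) {C : Set V} (hC : IsClosed C) (hCi : IsIrreducible C)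
    {σ : Type*} [Finite σ] (e : σ → ι) {h : MvPolynomial σ k} (hne : h ≠ 0)
    (hdom : ∀ y : σ → k, eval y h ≠ 0 → ∃ x ∈ C, c x ∘ e = y)
    (halg : ∀ j, ∃ p : MvPolynomial σ k, ∀ x ∈ C, eval (c x ∘ e) h ≠ 0 →
      eval (c x ∘ e) h * c x j = eval (c x ∘ e) p) :
    topologicalKrullDim C = Nat.card σ := by
  have hinf : Infinite k := IsAlgClosed.instInfinite
  set J := vanishingIdeal k (c '' C) with hJ
  have hJp : J.IsPrime := hc.isIrreducible_iff.1 hCi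
  have hr : Set.range (fun x : C => c x) = zeroLocus k J := by
    have := hc.preimage_zeroLocus_vanishingIdeal hC
    rw [← Set.image_preimage_eq (zeroLocus k J) hsurj, this, Set.image_eq_range]
  rw [(hc.comp_subtypeVal C).topologicalKrullDim_eq_of_range_eq hr]
  have hmk : ∀ p : MvPolynomial σ k,
      aeval (fun s => Ideal.Quotient.mk J (X (e s))) p = Ideal.Quotient.mk J (rename e p) :=
    fun p => by
      change _ = Ideal.Quotient.mkₐ k J (rename e p)
      rw [rename_eq_aeval, ← AlgHom.comp_apply, comp_aeval]
      rfl
  have hJmem : ∀ p : MvPolynomial σ k, rename e p ∈ J ↔ ∀ x ∈ C, eval (c x ∘ e) p = 0 := by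
    intro p
    simp [hJ, aeval_eq_eval, eval_rename]
  have hdense : ∀ p : MvPolynomial σ k, rename e p ∈ J → p = 0 := by
    intro p hp
    have h0 : p * h = 0 := by
      refine funext fun y => ?_
      by_cases hy : eval y h = 0
      · simp [hy]
      · obtain ⟨x, hx, rfl⟩ := hdom y hy
        simp [(hJmem p).1 hp x hx]
    exact (mul_eq_zero.1 h0).resolve_right hne
  have hind : AlgebraicIndependent k fun s => Ideal.Quotient.mk J (X (e s)) := by
    rw [algebraicIndependent_iff]
    intro p hp
    rw [hmk, Ideal.Quotient.eq_zero_iff_mem] at hp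
    exact hdense p hp
  refine ringKrullDim_eq_natCard_of_isTranscendenceBasis
    (isTranscendenceBasis_of_adjoin_eq_top hind
      (t := Set.range fun j => Ideal.Quotient.mk J (X j)) ?_ ?_)
  · change Algebra.adjoin k (Set.range (Ideal.Quotient.mkₐ k J ∘ X)) = ⊤
    rw [Set.range_comp, Algebra.adjoin_image, adjoin_range_X, Algebra.map_top]
    exact (AlgHom.range_eq_top _).2 (Ideal.Quotient.mkₐ_surjective k J)
  · rintro _ ⟨j, rfl⟩
    obtain ⟨p, hp⟩ := halg j
    have hmem : ∀ q : MvPolynomial σ k, Ideal.Quotient.mk J (rename e q) ∈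
        Algebra.adjoin k (Set.range fun s => Ideal.Quotient.mk J (X (e s))) := fun q => by
      rw [← hmk, Algebra.adjoin_range_eq_range_aeval]
      exact ⟨q, rfl⟩
    have hrel : rename e h * (rename e h * X j - rename e p) ∈ J := by
      rintro _ ⟨x, hx, rfl⟩
      by_cases h0 : eval (c x ∘ e) h = 0
      · rw [map_mul, aeval_eq_eval, eval_rename, h0, zero_mul]
      · have := hp x hx h0
        rw [aeval_eq_eval, map_mul, map_sub, map_mul, eval_X, eval_rename, eval_rename, this,
          sub_self, mul_zero]
    have hrel' := (hJp.mem_or_mem hrel).resolve_left fun hh => hne (hdense _ hh)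
    rw [← Ideal.Quotient.eq_zero_iff_mem, map_sub, map_mul, sub_eq_zero] at hrel'
    refine ⟨Polynomial.C ⟨_, hmem h⟩ * Polynomial.X - Polynomial.C ⟨_, hmem p⟩, fun h0 => ?_, ?_⟩
    · have := congrArg (fun q => Polynomial.coeff q 1) h0
      simp [Polynomial.coeff_C] at this
      exact hne (hdense h (Ideal.Quotient.eq_zero_iff_mem.1 (congrArg Subtype.val this)))
    · simp [hrel', Subalgebra.algebraMap_eq]

end IsZariskiChart

end Zariski

open Module in
theorem Submodule.exists_between_finrank_eq {k V : Type*} [Field k] [AddCommGroup V] [Module k V]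
    [FiniteDimensional k V] {A B : Submodule k V} (hAB : A ≤ B) {r : ℕ} (hA : finrank k A ≤ r)
    (hB : r ≤ finrank k B) : ∃ W, A ≤ W ∧ W ≤ B ∧ finrank k W = r := by
  induction r, hA using Nat.le_induction with
  | base => exact ⟨A, le_rfl, hAB, rfl⟩
  | succ r _ ih =>
    obtain ⟨W, hAW, hWB, hW⟩ := ih (by lia)
    obtain ⟨v, hvB, hvW⟩ : ∃ v ∈ B, v ∉ W := by
      by_contra! h
      have := Submodule.finrank_mono (R := k) (show B ≤ W from h)
      lia
    refine ⟨W ⊔ k ∙ v, hAW.trans le_sup_left,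
      sup_le hWB ((Submodule.span_singleton_le_iff_mem _ _).2 hvB), ?_⟩
    rw [Submodule.finrank_sup_span_singleton hvW, hW]

/-- Every `r`-dimensional subspace of `k ^ f` is carried to the span of the first `r` standard
basis vectors by an invertible matrix. -/
theorem Submodule.exists_isUnit_det_forall_mem_iff {k : Type*} [Field k] {f r : ℕ}
    (W : Submodule k (Fin f → k)) (hW : Module.finrank k W = r) :
    ∃ P : Matrix (Fin f) (Fin f) k, IsUnit P.det ∧
      ∀ v, v ∈ W ↔ ∀ i : Fin f, r ≤ i → (P⁻¹.mulVec v) i = 0 := by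
  obtain ⟨W', hWW'⟩ := W.exists_isCompl
  have hfin := Submodule.finrank_add_eq_of_isCompl hWW'
  rw [hW, Module.finrank_fin_fun] at hfin
  let ε : Fin r ⊕ Fin (f - r) ≃ Fin f := finSumFinEquiv.trans (finCongr (by lia))
  let b₁ := Module.finBasisOfFinrankEq k W hW
  let b₂ := Module.finBasisOfFinrankEq k W' (show _ = f - r by lia)
  let b : Module.Basis (Fin f) k (Fin f → k) :=
    ((b₁.prod b₂).map (Submodule.prodEquivOfIsCompl W W' hWW')).reindex ε
  have hinv : (((Pi.basisFun k (Fin f)).toMatrix b)⁻¹) = b.toMatrix (Pi.basisFun k (Fin f)) :=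
    Matrix.inv_eq_right_inv (Module.Basis.toMatrix_mul_toMatrix_flip _ _)
  refine ⟨(Pi.basisFun k (Fin f)).toMatrix b, ?_, fun v => ?_⟩
  · rw [← Matrix.isUnit_iff_isUnit_det]
    exact IsUnit.of_mul_eq_one _ (Module.Basis.toMatrix_mul_toMatrix_flip _ _)
  · have hv : (((Pi.basisFun k (Fin f)).toMatrix b)⁻¹).mulVec v = b.repr v := by
      rw [hinv]
      exact (Pi.basisFun k (Fin f)).toMatrix_mulVec_repr b v
    have hsnd : v ∈ W ↔ ∀ j : Fin (f - r), b.repr v (ε (Sum.inr j)) = 0 := by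
      rw [← Submodule.prodEquivOfIsCompl_symm_apply_snd_eq_zero W W' hWW',
        ← b₂.repr.map_eq_zero_iff, Finsupp.ext_iff]
      simp [b]
    rw [hv, hsnd]
    constructor
    · intro h i hi
      obtain ⟨s | s, rfl⟩ := ε.surjective i
      · have := s.2
        simp [ε] at hi
        lia
      · exact h s
    · intro h j
      exact h _ (by simp [ε])

section NormalForm

open Matrix

variable {k : Type*} {a f g : ℕ}

/-- The projection onto the first `r` coordinates. -/
def Matrix.truncOne (R : Type*) [CommRing R] (f r : ℕ) : Matrix (Fin f) (Fin f) R :=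
  Matrix.diagonal fun i => if (i : ℕ) < r then 1 else 0

theorem Matrix.exists_normalForm [Field k] {M : Matrix (Fin a) (Fin f) k}
    {L : Matrix (Fin f) (Fin g) k} (hML : M * L = 0) {r : ℕ} (hL : L.rank ≤ r)
    (hM : M.rank + r ≤ f) :
    ∃ (P : Matrix (Fin f) (Fin f) k) (N : Matrix (Fin a) (Fin f) k)
      (T : Matrix (Fin f) (Fin g) k), P.det ≠ 0 ∧ M = N * (1 - truncOne k f r) * P.adjugate ∧
        L = P * truncOne k f r * T := by
  have hrange : LinearMap.range L.mulVecLin ≤ LinearMap.ker M.mulVecLin := by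
    rintro _ ⟨v, rfl⟩
    simp [hML]
  have hker := M.mulVecLin.finrank_range_add_finrank_ker
  rw [Module.finrank_fin_fun] at hker
  obtain ⟨W, hLW, hWM, hW⟩ := Submodule.exists_between_finrank_eq hrange (r := r) hL
    (by rw [Matrix.rank] at hM; lia)
  obtain ⟨P, hP, hPW⟩ := W.exists_isUnit_det_forall_mem_iff hW
  have hL' : truncOne k f r * (P⁻¹ * L) = P⁻¹ * L := by
    ext i j
    rw [truncOne, diagonal_mul]
    split_ifs with h
    · rw [one_mul]
    · have := (hPW (L.mulVec (Pi.single j 1))).1 (hLW ⟨_, rfl⟩) i (not_lt.1 h)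
      rw [mulVec_mulVec, mulVec_single_one] at this
      rw [zero_mul, ← this, col_apply]
  have hM' : M * (P * truncOne k f r) = 0 := by
    ext i j
    have : (P * truncOne k f r).mulVec (Pi.single j 1) ∈ W := by
      rw [hPW]
      intro i hi
      rw [mulVec_mulVec, nonsing_inv_mul_cancel_left _ _ hP, mulVec_single_one, col_apply,
        truncOne, diagonal_apply]
      split_ifs <;> first | rfl | (subst_vars; lia)
    have := congrFun (hWM this) i
    rwa [mulVec_single_one] at this
  refine ⟨P, P.det⁻¹ • (M * P), P⁻¹ * L, hP.ne_zero, ?_, ?_⟩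
  · rw [smul_mul, smul_mul, Matrix.mul_sub, Matrix.mul_one, Matrix.mul_assoc M P (truncOne k f r),
      hM', sub_zero, Matrix.mul_assoc, mul_adjugate, Matrix.mul_smul, Matrix.mul_one, smul_smul,
      inv_mul_cancel₀ hP.ne_zero, one_smul]
  · rw [Matrix.mul_assoc, hL', mul_nonsing_inv_cancel_left _ _ hP]

theorem Matrix.mul_truncOne_self [CommRing k] (r : ℕ) :
    (1 - truncOne k f r) * truncOne k f r = 0 := by
  rw [sub_mul, one_mul, truncOne, diagonal_mul_diagonal, sub_eq_zero]
  congr 1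
  ext i
  split_ifs <;> simp

theorem Matrix.rank_one_sub_truncOne_add_le [Field k] {r : ℕ} (hr : r ≤ f) :
    (1 - truncOne k f r).rank + r ≤ f := by
  classical
  have h1 : 1 - truncOne k f r = diagonal fun i : Fin f => if (i : ℕ) < r then 0 else 1 := by
    rw [truncOne, ← diagonal_one, diagonal_sub]
    congr 1
    ext i
    split_ifs <;> simp
  rw [h1, rank_diagonal]
  have := Fintype.card_le_of_injective
    (fun i : {i : Fin f // (if (i : ℕ) < r then (0 : k) else 1) ≠ 0} => (⟨i.1 - r, by
      have h2 : ¬ ((i.1 : ℕ) < r) := fun h => i.2 (if_pos h)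
      lia⟩ : Fin (f - r))) fun i j h => by
        have hi : ¬ ((i.1 : ℕ) < r) := fun h => i.2 (if_pos h)
        have hj : ¬ ((j.1 : ℕ) < r) := fun h => j.2 (if_pos h)
        simp only [Fin.mk.injEq] at h
        exact Subtype.ext (Fin.ext (by lia))
  rw [Fintype.card_fin] at this
  lia

theorem Matrix.rank_truncOne_le [Field k] (r : ℕ) : (truncOne k f r).rank ≤ r := by
  classical
  rw [truncOne, rank_diagonal]
  have := Fintype.card_le_of_injective
    (fun i : {i : Fin f // (if (i : ℕ) < r then (1 : k) else 0) ≠ 0} => (⟨i.1, by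
      by_contra h; exact i.2 (if_neg h)⟩ : Fin r)) fun i j h => by
        simpa [Subtype.ext_iff, Fin.ext_iff] using h
  simpa using this

end NormalForm

section MatPair

theorem MatPair.coords_surjective {k : Type*} {a f g : ℕ} :
    Function.Surjective (MatPair.coords : MatPair k a f g → _) := fun y =>
  ⟨(Matrix.of fun i j => y (.inl (i, j)), Matrix.of fun i j => y (.inr (i, j))), by
    ext (q | q) <;> rfl⟩

open MvPolynomial Topology

variable {k : Type*} [Field k] {a f g : ℕ}

/-- The topology generated by the principal open sets is the Zariski topology. -/
theorem isZariskiChart_generateFrom {k ι V : Type*} [Field k] (c : V → ι → k) :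
    letI := TopologicalSpace.generateFrom
      {s : Set V | ∃ p : MvPolynomial ι k, s = {x | eval (c x) p ≠ 0}}
    IsZariskiChart c := by
  let _ := TopologicalSpace.generateFrom
    {s : Set V | ∃ p : MvPolynomial ι k, s = {x | eval (c x) p ≠ 0}}
  intro s
  constructor
  · intro hs
    suffices h : ∀ u : Set V, IsOpen u → ∃ I : Ideal (MvPolynomial ι k),
        uᶜ = c ⁻¹' zeroLocus k I by
      simpa using h _ hs.isOpen_compl
    intro u hu
    induction hu with
    | basic u hu =>
      obtain ⟨p, rfl⟩ := hu
      refine ⟨Ideal.span {p}, ?_⟩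
      ext x
      simp [zeroLocus_span, aeval_eq_eval]
    | univ => exact ⟨⊤, by simp [zeroLocus_top]⟩
    | inter u v _ _ hu hv =>
      obtain ⟨I, hI⟩ := hu
      obtain ⟨J, hJ⟩ := hv
      refine ⟨I * J, ?_⟩
      rw [Set.compl_inter, hI, hJ]
      ext x
      simp only [Set.mem_union, Set.mem_preimage, mem_zeroLocus_iff]
      constructor
      · rintro (h | h) p hp
        · exact h p (Ideal.mul_le_left hp)
        · exact h p (Ideal.mul_le_right hp)
      · intro h
        by_contra! hc
        obtain ⟨⟨p, hp, hp'⟩, q, hq, hq'⟩ := hc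
        have := h _ (Ideal.mul_mem_mul hp hq)
        rw [map_mul] at this
        exact (mul_ne_zero hp' hq') this
    | sUnion S _ ih =>
      choose I hI using ih
      refine ⟨⨆ (u) (hu : u ∈ S), I u hu, ?_⟩
      ext x
      have : ∀ u (hu : u ∈ S),
          x ∉ u ↔ I u hu ≤ RingHom.ker (aeval (c x) : MvPolynomial ι k →ₐ[k] k) := by
        intro u hu
        rw [← Set.mem_compl_iff, hI u hu]
        rfl
      change _ ↔ (⨆ (u) (hu : u ∈ S), I u hu) ≤
        RingHom.ker (aeval (c x) : MvPolynomial ι k →ₐ[k] k)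
      simp only [iSup_le_iff, ← this]
      simp
  · rintro ⟨I, rfl⟩
    have : c ⁻¹' zeroLocus k I = ⋂ p ∈ I, {x : V | eval (c x) p ≠ 0}ᶜ := by
      ext x
      simp [mem_zeroLocus_iff, aeval_eq_eval]
    rw [this]
    exact isClosed_biInter fun p _ =>
      IsOpen.isClosed_compl (TopologicalSpace.isOpen_generateFrom_of_mem ⟨p, rfl⟩)

theorem isZariskiChart_coords :
    letI : TopologicalSpace (MatPair k a f g) := matPairZariski k a f g
    IsZariskiChart (MatPair.coords : MatPair k a f g → _) :=
  isZariskiChart_generateFrom _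

theorem isOpen_matPair_of_eval {ρ : MatPair k a f g → k} (p : MvPolynomial _ k)
    (hp : ∀ x, eval x.coords p = ρ x) : IsOpen[matPairZariski k a f g] {x | ρ x ≠ 0} := by
  have : {x | ρ x ≠ 0} = {x : MatPair k a f g | eval x.coords p ≠ 0} := by simp [hp]
  rw [this]
  exact TopologicalSpace.isOpen_generateFrom_of_mem
    (g := {s | ∃ p, s = {x : MatPair k a f g | eval x.coords p ≠ 0}}) ⟨p, rfl⟩

namespace MatPair

/-- The first generic matrix. -/
noncomputable def genericFst (k : Type*) [Field k] (a f g : ℕ) :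
    Matrix (Fin a) (Fin f) (MvPolynomial ((Fin a × Fin f) ⊕ (Fin f × Fin g)) k) :=
  Matrix.of fun i j => X (.inl (i, j))

/-- The second generic matrix. -/
noncomputable def genericSnd (k : Type*) [Field k] (a f g : ℕ) :
    Matrix (Fin f) (Fin g) (MvPolynomial ((Fin a × Fin f) ⊕ (Fin f × Fin g)) k) :=
  Matrix.of fun i j => X (.inr (i, j))

theorem map_genericFst (x : MatPair k a f g) :
    (genericFst k a f g).map (eval x.coords) = x.1 := by
  ext; simp [genericFst, coords]

theorem map_genericSnd (x : MatPair k a f g) :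
    (genericSnd k a f g).map (eval x.coords) = x.2 := by
  ext; simp [genericSnd, coords]

theorem isOpen_det_mul_snd_ne_zero (N : Matrix (Fin g) (Fin f) k) :
    IsOpen[matPairZariski k a f g] {x : MatPair k a f g | (N * x.2).det ≠ 0} := by
  let E : Matrix (Fin g) (Fin g) (MvPolynomial ((Fin a × Fin f) ⊕ (Fin f × Fin g)) k) :=
    N.map C * genericSnd k a f g
  refine isOpen_matPair_of_eval E.det fun x => ?_
  rw [RingHom.map_det, RingHom.mapMatrix_apply, show E.map (eval x.coords) = _ from Matrix.map_mul,
    map_genericSnd]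
  congr 2
  ext
  simp

theorem isOpen_det_submatrix_fst_ne_zero {m : ℕ} (u : Fin m → Fin a) (v : Fin m → Fin f) :
    IsOpen[matPairZariski k a f g] {x : MatPair k a f g | (x.1.submatrix u v).det ≠ 0} := by
  refine isOpen_matPair_of_eval ((genericFst k a f g).submatrix u v).det fun x => ?_
  rw [RingHom.map_det, RingHom.mapMatrix_apply, ← Matrix.submatrix_map, map_genericFst]

theorem isClosed_mul_eq_zero :
    IsClosed[matPairZariski k a f g] {x : MatPair k a f g | x.1 * x.2 = 0} := by
  let _ : TopologicalSpace (MatPair k a f g) := matPairZariski k a f g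
  have : {x : MatPair k a f g | x.1 * x.2 = 0} =
      ⋂ (i) (j), {x : MatPair k a f g | (x.1 * x.2) i j ≠ 0}ᶜ := by
    ext x
    simp [← Matrix.ext_iff]
  rw [this]
  refine isClosed_iInter fun i => isClosed_iInter fun j => IsOpen.isClosed_compl ?_
  refine isOpen_matPair_of_eval ((genericFst k a f g * genericSnd k a f g) i j) fun x => ?_
  rw [← Matrix.map_apply (f := eval x.coords), Matrix.map_mul, map_genericFst, map_genericSnd]

end MatPair

theorem Matrix.rank_eq_width_iff_exists_det_mul_ne_zero {L : Matrix (Fin f) (Fin g) k} :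
    L.rank = g ↔ ∃ N : Matrix (Fin g) (Fin f) k, (N * L).det ≠ 0 := by
  constructor
  · intro hL
    have hker : LinearMap.ker L.mulVecLin = ⊥ := by
      have := L.mulVecLin.finrank_range_add_finrank_ker
      rw [Module.finrank_fin_fun] at this
      rw [Matrix.rank] at hL
      exact Submodule.finrank_eq_zero.1 (by lia)
    obtain ⟨φ, hφ⟩ := L.mulVecLin.exists_leftInverse_of_injective hker
    refine ⟨LinearMap.toMatrix' φ, ?_⟩
    have : LinearMap.toMatrix' φ * L = 1 := by
      rw [← LinearMap.toMatrix'_toLin' L, ← LinearMap.toMatrix'_comp, Matrix.toLin'_apply', hφ,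
        LinearMap.toMatrix'_id]
    simp [this]
  · rintro ⟨N, hN⟩
    apply le_antisymm (L.rank_le_width)
    have := Matrix.rank_of_isUnit (N * L)
      ((Matrix.isUnit_iff_isUnit_det _).2 (isUnit_iff_ne_zero.2 hN))
    rw [Fintype.card_fin] at this
    exact this.symm.trans_le (Matrix.rank_mul_le_right N L)

theorem MatPair.isOpen_rank_snd_eq :
    IsOpen[matPairZariski k a f g] {x : MatPair k a f g | x.2.rank = g} := by
  let _ : TopologicalSpace (MatPair k a f g) := matPairZariski k a f g
  simp only [Matrix.rank_eq_width_iff_exists_det_mul_ne_zero, Set.ofPred_exists]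
  exact isOpen_iUnion isOpen_det_mul_snd_ne_zero

/-- Pairs `(M, L)` for which some `r`-dimensional subspace lies between the range of `L` and the
kernel of `M`. -/
def MatPair.stratum (k : Type*) [Field k] (a f g r : ℕ) : Set (MatPair k a f g) :=
  {x | x.1 * x.2 = 0 ∧ x.2.rank ≤ r ∧ x.1.rank + r ≤ f}

theorem MatPair.isIrreducible_stratum [Infinite k] {r : ℕ} (hr : r ≤ f) :
    letI : TopologicalSpace (MatPair k a f g) := matPairZariski k a f g
    IsIrreducible (MatPair.stratum k a f g r) := by
  let _ : TopologicalSpace (MatPair k a f g) := matPairZariski k a f g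
  let τ := (Fin f × Fin f) ⊕ (Fin a × Fin f) ⊕ (Fin f × Fin g)
  let P : Matrix (Fin f) (Fin f) (MvPolynomial τ k) := .of fun i j => X (.inl (i, j))
  let N : Matrix (Fin a) (Fin f) (MvPolynomial τ k) := .of fun i j => X (.inr (.inl (i, j)))
  let T : Matrix (Fin f) (Fin g) (MvPolynomial τ k) := .of fun i j => X (.inr (.inr (i, j)))
  let D := Matrix.truncOne (MvPolynomial τ k) f r
  let E₁ : Matrix (Fin a) (Fin f) (MvPolynomial τ k) := N * (1 - D) * P.adjugate
  let E₂ : Matrix (Fin f) (Fin g) (MvPolynomial τ k) := P * D * T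
  have hD : ∀ y : τ → k, D.map (eval y) = Matrix.truncOne k f r := fun y => by
    ext i j
    simp only [D, Matrix.truncOne, Matrix.map_apply, Matrix.diagonal_apply]
    split_ifs <;> simp
  have hdet : ∀ y : τ → k, eval y P.det = (P.map (eval y)).det := fun y => RingHom.map_det _ _
  have hfst : ∀ y : τ → k, E₁.map (eval y) =
      N.map (eval y) * (1 - Matrix.truncOne k f r) * (P.map (eval y)).adjugate := fun y => by
    have := RingHom.map_adjugate (eval y) P
    simp only [RingHom.mapMatrix_apply] at this
    rw [Matrix.map_mul, Matrix.map_mul, this, Matrix.map_sub _ (by simp), hD,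
      Matrix.map_one _ (by simp) (by simp)]
  have hsnd : ∀ y : τ → k, E₂.map (eval y) =
      P.map (eval y) * Matrix.truncOne k f r * T.map (eval y) := fun y => by
    rw [Matrix.map_mul, Matrix.map_mul, hD]
  have hcoords : ∀ y : τ → k, (fun i => eval y (Sum.elim (fun q => E₁ q.1 q.2)
      (fun q => E₂ q.1 q.2) i)) = MatPair.coords
        (N.map (eval y) * (1 - Matrix.truncOne k f r) * (P.map (eval y)).adjugate,
          P.map (eval y) * Matrix.truncOne k f r * T.map (eval y)) := fun y => by
    rw [← hfst, ← hsnd]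
    ext (q | q) <;> rfl
  refine isZariskiChart_coords.isIrreducible_of_parametrization
    (Sum.elim (fun q => E₁ q.1 q.2) (fun q => E₂ q.1 q.2))
    (q := P.det) ?_ ?_ ?_
  · intro h
    have := hdet (Sum.elim (fun q => if q.1 = q.2 then 1 else 0) 0)
    rw [h, map_zero] at this
    have h1 : P.map (eval (Sum.elim (fun q => if q.1 = q.2 then 1 else 0) 0)) = 1 := by
      ext i j
      simp [P, Matrix.one_apply]
    rw [h1, Matrix.det_one] at this
    exact zero_ne_one this
  · rintro x ⟨hx, hL, hM⟩
    obtain ⟨P', N', T', hP', hM', hL'⟩ := Matrix.exists_normalForm hx hL hM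
    let y : τ → k := Sum.elim (fun q => P' q.1 q.2)
      (Sum.elim (fun q => N' q.1 q.2) (fun q => T' q.1 q.2))
    have hP : P.map (eval y) = P' := by ext; simp [P, y]
    have hN : N.map (eval y) = N' := by ext; simp [N, y]
    have hT : T.map (eval y) = T' := by ext; simp [T, y]
    refine ⟨y, by rwa [hdet, hP], ?_⟩
    rw [hcoords, hP, hN, hT, ← hM', ← hL']
  · intro y hy
    rw [hdet] at hy
    refine ⟨_, ⟨?_, ?_, ?_⟩, (hcoords y).symm⟩
    · simp only [Matrix.mul_assoc]
      rw [← Matrix.mul_assoc (Matrix.adjugate _), Matrix.adjugate_mul, Matrix.smul_mul,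
        Matrix.one_mul, Matrix.mul_smul, ← Matrix.mul_assoc (1 - _), Matrix.mul_truncOne_self]
      simp
    · exact (Matrix.rank_mul_le_left _ _).trans ((Matrix.rank_mul_le_right _ _).trans
        (Matrix.rank_truncOne_le r))
    · refine le_trans (Nat.add_le_add_right ((Matrix.rank_mul_le_left _ _).trans
        (Matrix.rank_mul_le_right _ _)) r) ?_
      exact Matrix.rank_one_sub_truncOne_add_le hr

end MatPair

section Solve

open Matrix

variable {R : Type*} [CommRing R] {a f g r : ℕ}

/-- The inclusion of the first `r` coordinates. -/
def Matrix.firstRows (R : Type*) [CommRing R] (hf : r ≤ f) : Matrix (Fin r) (Fin f) R :=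
  (1 : Matrix (Fin f) (Fin f) R).submatrix (Fin.castLE hf) id

theorem Matrix.firstRows_mul (hf : r ≤ f) (L : Matrix (Fin f) (Fin g) R) :
    firstRows R hf * L = L.submatrix (Fin.castLE hf) id := by
  ext i j
  simp [firstRows, mul_apply, one_apply]

theorem Matrix.firstRows_apply (hf : r ≤ f) (i : Fin r) (j : Fin f) :
    firstRows R hf i j = if (i : ℕ) = j then 1 else 0 := by
  simp [firstRows, one_apply, Fin.ext_iff]

/-- The determinant of the upper left `r × r` block. -/
def Matrix.cornerDet (hf : r ≤ f) (hg : r ≤ g) (L : Matrix (Fin f) (Fin g) R) : R :=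
  (L.submatrix (Fin.castLE hf) (Fin.castLE hg)).det

/-- The determinant of the upper left `r × r` block times the rank `r` matrix with the same first
`r` rows and columns. -/
def Matrix.solveSnd (hf : r ≤ f) (hg : r ≤ g) (L : Matrix (Fin f) (Fin g) R) :
    Matrix (Fin f) (Fin g) R :=
  L.submatrix id (Fin.castLE hg) * (L.submatrix (Fin.castLE hf) (Fin.castLE hg)).adjugate *
    L.submatrix (Fin.castLE hf) id

/-- The determinant of the upper left `r × r` block of `L` times the matrix which annihilates the
first `r` columns of `L` and agrees with `M` outside the first `r` columns. -/
def Matrix.solveFst (hf : r ≤ f) (hg : r ≤ g) (M : Matrix (Fin a) (Fin f) R)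
    (L : Matrix (Fin f) (Fin g) R) : Matrix (Fin a) (Fin f) R :=
  cornerDet hf hg L • M - M * (L.submatrix id (Fin.castLE hg) *
    (L.submatrix (Fin.castLE hf) (Fin.castLE hg)).adjugate * firstRows R hf)

namespace Matrix

variable {S : Type*} [CommRing S] (φ : R →+* S)

theorem map_cornerDet (hf : r ≤ f) (hg : r ≤ g) (L : Matrix (Fin f) (Fin g) R) :
    φ (cornerDet hf hg L) = cornerDet hf hg (L.map φ) := by
  rw [cornerDet, RingHom.map_det, RingHom.mapMatrix_apply, ← submatrix_map, cornerDet]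

theorem map_solveSnd (hf : r ≤ f) (hg : r ≤ g) (L : Matrix (Fin f) (Fin g) R) :
    (solveSnd hf hg L).map φ = solveSnd hf hg (L.map φ) := by
  have := RingHom.map_adjugate φ (L.submatrix (Fin.castLE hf) (Fin.castLE hg))
  simp only [RingHom.mapMatrix_apply] at this
  simp only [solveSnd, Matrix.map_mul, this, submatrix_map]

theorem map_solveFst (hf : r ≤ f) (hg : r ≤ g) (M : Matrix (Fin a) (Fin f) R)
    (L : Matrix (Fin f) (Fin g) R) :
    (solveFst hf hg M L).map φ = solveFst hf hg (M.map φ) (L.map φ) := by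
  have := RingHom.map_adjugate φ (L.submatrix (Fin.castLE hf) (Fin.castLE hg))
  simp only [RingHom.mapMatrix_apply] at this
  have h1 : (firstRows R hf).map φ = firstRows S hf := by
    rw [firstRows, ← submatrix_map, Matrix.map_one _ (map_zero φ) (map_one φ), firstRows]
  have h2 : (cornerDet hf hg L • M).map φ = φ (cornerDet hf hg L) • M.map φ := by
    ext
    simp
  rw [solveFst, Matrix.map_sub _ (map_sub φ), h2, Matrix.map_mul,
    Matrix.map_mul, Matrix.map_mul, this, h1, map_cornerDet]
  rfl

variable (hf : r ≤ f) (hg : r ≤ g)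

theorem firstRows_mul_columns (L : Matrix (Fin f) (Fin g) R) :
    firstRows R hf * L.submatrix id (Fin.castLE hg) =
      L.submatrix (Fin.castLE hf) (Fin.castLE hg) := by
  rw [firstRows_mul, submatrix_submatrix]
  rfl

theorem solveSnd_submatrix_rows (L : Matrix (Fin f) (Fin g) R) :
    (solveSnd hf hg L).submatrix (Fin.castLE hf) id =
      cornerDet hf hg L • L.submatrix (Fin.castLE hf) id := by
  rw [← firstRows_mul, solveSnd, ← Matrix.mul_assoc, ← Matrix.mul_assoc, firstRows_mul_columns,
    mul_adjugate, smul_mul, Matrix.one_mul]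
  rfl

theorem solveSnd_submatrix_columns (L : Matrix (Fin f) (Fin g) R) :
    (solveSnd hf hg L).submatrix id (Fin.castLE hg) =
      cornerDet hf hg L • L.submatrix id (Fin.castLE hg) := by
  have : (solveSnd hf hg L).submatrix id (Fin.castLE hg) =
      L.submatrix id (Fin.castLE hg) * (L.submatrix (Fin.castLE hf) (Fin.castLE hg)).adjugate *
        L.submatrix (Fin.castLE hf) (Fin.castLE hg) := by
    ext
    rfl
  rw [this, Matrix.mul_assoc, adjugate_mul, Matrix.mul_smul, Matrix.mul_one]
  rfl

theorem solveFst_apply_of_le (M : Matrix (Fin a) (Fin f) R) (L : Matrix (Fin f) (Fin g) R)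
    (i : Fin a) {j : Fin f} (hj : r ≤ j) :
    solveFst hf hg M L i j = cornerDet hf hg L * M i j := by
  have h0 : ∀ s : Fin r, firstRows R hf s j = 0 := fun s => by
    rw [firstRows_apply, if_neg (by lia)]
  rw [solveFst, ← Matrix.mul_assoc, sub_apply, smul_apply, mul_apply (N := firstRows R hf)]
  simp [h0]

theorem solveFst_mul_solveSnd (M : Matrix (Fin a) (Fin f) R) (L : Matrix (Fin f) (Fin g) R) :
    solveFst hf hg M L * solveSnd hf hg L = 0 := by
  rw [solveFst, solveSnd, Matrix.sub_mul, sub_eq_zero, smul_mul, Matrix.mul_assoc M]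
  simp only [Matrix.mul_assoc]
  rw [← Matrix.mul_assoc (firstRows R hf), firstRows_mul_columns, ← Matrix.mul_assoc
    (L.submatrix (Fin.castLE hf) (Fin.castLE hg)) (adjugate _), mul_adjugate, smul_mul,
    Matrix.one_mul]
  simp only [Matrix.mul_smul]
  rfl

/-- The matrix `M` is recovered from its last columns if it annihilates the first columns of `L`. -/
theorem solveFst_eq_of_mul_eq_zero {M M' : Matrix (Fin a) (Fin f) R}
    {L : Matrix (Fin f) (Fin g) R} (hML : M * L = 0)
    (hM : ∀ i j, M' i j = if r ≤ (j : ℕ) then M i j else 0) :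
    solveFst hf hg M' L = cornerDet hf hg L • M := by
  have hsplit : M = M.submatrix id (Fin.castLE hf) * firstRows R hf + M' := by
    ext i j
    rw [add_apply, hM, mul_apply]
    split_ifs with h
    · have h0 : ∀ s : Fin r, firstRows R hf s j = 0 := fun s => by
        rw [firstRows_apply, if_neg (by lia)]
      simp [h0]
    · rw [Finset.sum_eq_single ⟨j, by lia⟩]
      · simp [firstRows_apply]
      · intro s _ hs
        rw [firstRows_apply, if_neg (by simpa [Fin.ext_iff] using hs), mul_zero]
      · simp
  have h1 : M * L.submatrix id (Fin.castLE hg) = 0 := by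
    change (M * L).submatrix id (Fin.castLE hg) = 0
    rw [hML]
    rfl
  have h2 : M' * L.submatrix id (Fin.castLE hg) =
      -(M.submatrix id (Fin.castLE hf) * L.submatrix (Fin.castLE hf) (Fin.castLE hg)) := by
    rw [← firstRows_mul_columns, ← Matrix.mul_assoc, eq_neg_iff_add_eq_zero, add_comm,
      ← Matrix.add_mul, ← hsplit, h1]
  rw [solveFst, ← Matrix.mul_assoc, ← Matrix.mul_assoc, h2, Matrix.neg_mul, Matrix.mul_assoc _ _
    (adjugate _), mul_adjugate, Matrix.mul_smul, Matrix.mul_one, Matrix.neg_mul, sub_neg_eq_add,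
    smul_mul]
  change cornerDet hf hg L • M' + cornerDet hf hg L • _ = _
  rw [← smul_add, add_comm, ← hsplit]

section Field

variable {k : Type*} [Field k]

theorem le_rank_of_cornerDet_ne_zero {L : Matrix (Fin f) (Fin g) k}
    (hL : cornerDet hf hg L ≠ 0) : r ≤ (L.submatrix id (Fin.castLE hg)).rank := by
  have h := rank_of_isUnit _ ((isUnit_iff_isUnit_det _).2 (isUnit_iff_ne_zero.2 hL))
  rw [Fintype.card_fin] at h
  rw [← firstRows_mul_columns] at h
  exact h.symm.trans_le (rank_mul_le_right _ _)

theorem solveSnd_eq_of_rank_le {L : Matrix (Fin f) (Fin g) k} (hL : cornerDet hf hg L ≠ 0)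
    (hr : L.rank ≤ r) : solveSnd hf hg L = cornerDet hf hg L • L := by
  have hle : LinearMap.range (L.submatrix id (Fin.castLE hg)).mulVecLin ≤
      LinearMap.range L.mulVecLin := by
    rw [range_mulVecLin, range_mulVecLin]
    refine Submodule.span_mono ?_
    rintro _ ⟨j, rfl⟩
    exact ⟨Fin.castLE hg j, rfl⟩
  have heq := Submodule.eq_of_le_of_finrank_le hle
    (hr.trans (le_rank_of_cornerDet_ne_zero hf hg hL))
  have hcol : ∀ j, ∃ v, (L.submatrix id (Fin.castLE hg)).mulVec v = L.col j := fun j => by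
    have : L.col j ∈ LinearMap.range L.mulVecLin := ⟨Pi.single j 1, by simp⟩
    rwa [← heq] at this
  choose v hv using hcol
  have hLX : L = L.submatrix id (Fin.castLE hg) * (Matrix.of v)ᵀ := by
    ext i j
    exact (congrFun (hv j) i).symm
  have hLt : L.submatrix (Fin.castLE hf) id =
      L.submatrix (Fin.castLE hf) (Fin.castLE hg) * (Matrix.of v)ᵀ := by
    rw [← firstRows_mul, ← firstRows_mul_columns, Matrix.mul_assoc, ← hLX]
  rw [solveSnd, hLt, ← Matrix.mul_assoc, Matrix.mul_assoc _ (adjugate _), adjugate_mul,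
    Matrix.mul_smul, Matrix.mul_one, smul_mul, ← hLX]
  rfl

theorem rank_smul_solveSnd {L : Matrix (Fin f) (Fin g) k} (hL : cornerDet hf hg L ≠ 0) :
    ((cornerDet hf hg L)⁻¹ • solveSnd hf hg L).rank = r := by
  apply le_antisymm
  · rw [solveSnd, ← Matrix.smul_mul]
    exact (rank_mul_le_right _ _).trans (rank_le_height _)
  · refine le_trans ?_ (rank_submatrix_le _ id (Fin.castLE hg))
    rw [submatrix_smul]
    simp only [Pi.smul_apply]
    rw [solveSnd_submatrix_columns, smul_smul, inv_mul_cancel₀ hL, one_smul]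
    exact le_rank_of_cornerDet_ne_zero hf hg hL

end Field

end Matrix

end Solve

section Dimension

open MvPolynomial Topology

/-- Index set of the entries of `(M, L)` in the last `f - r` columns of `M`, the first `r` columns
of `L` and the first `r` rows of `L`. -/
abbrev FreeEntries (a f g r : ℕ) : Type :=
  (Fin a × {j : Fin f // r ≤ j}) ⊕ (Fin f × Fin r) ⊕ (Fin r × {j : Fin g // r ≤ j})

namespace FreeEntries

variable {R S : Type*} [CommRing R] [CommRing S] {a f g r : ℕ}

theorem natCard_eq : Nat.card (FreeEntries a f g r) = a * (f - r) + (f * r + r * (g - r)) := by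
  have h : ∀ n : ℕ, Fintype.card {j : Fin n // r ≤ j} = n - r := fun n => by
    have h1 := Fintype.card_subtype_compl fun j : Fin n => (j : ℕ) < r
    simp only [not_lt] at h1
    rw [h1, Fintype.card_fin, Fintype.card_subtype, Fin.card_filter_val_lt]
    lia
  simp [h]

/-- The position of a free entry. -/
def toEntry (hf : r ≤ f) (hg : r ≤ g) :
    FreeEntries a f g r → (Fin a × Fin f) ⊕ (Fin f × Fin g) :=
  Sum.map (Prod.map id Subtype.val)
    (Sum.elim (Prod.map id (Fin.castLE hg)) (Prod.map (Fin.castLE hf) Subtype.val))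

/-- The matrix `M` with the given free entries and zeros elsewhere. -/
def fst (y : FreeEntries a f g r → R) : Matrix (Fin a) (Fin f) R :=
  .of fun i j => if h : r ≤ (j : ℕ) then y (.inl (i, ⟨j, h⟩)) else 0

/-- The matrix `L` with the given free entries and zeros elsewhere. -/
def snd (y : FreeEntries a f g r → R) : Matrix (Fin f) (Fin g) R :=
  .of fun i j => if h : r ≤ (j : ℕ) then
    if h' : (i : ℕ) < r then y (.inr (.inr (⟨i, h'⟩, ⟨j, h⟩))) else 0
      else y (.inr (.inl (i, ⟨j, not_le.1 h⟩)))

theorem map_fst (φ : R →+* S) (y : FreeEntries a f g r → R) : (fst y).map φ = fst (φ ∘ y) := by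
  ext i j
  simp only [fst, Matrix.map_apply, Matrix.of_apply]
  split_ifs <;> simp

theorem map_snd (φ : R →+* S) (y : FreeEntries a f g r → R) : (snd y).map φ = snd (φ ∘ y) := by
  ext i j
  simp only [snd, Matrix.map_apply, Matrix.of_apply]
  split_ifs <;> simp

variable (hf : r ≤ f) (hg : r ≤ g)

theorem fst_coords_comp_toEntry_apply (x : MatPair R a f g) (i : Fin a) (j : Fin f) :
    fst (x.coords ∘ toEntry hf hg) i j = if r ≤ (j : ℕ) then x.1 i j else 0 := by
  simp only [fst, Matrix.of_apply]
  split_ifs <;> rfl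

theorem snd_coords_comp_toEntry_apply (x : MatPair R a f g) {i : Fin f} {j : Fin g}
    (hij : (i : ℕ) < r ∨ (j : ℕ) < r) : snd (x.coords ∘ toEntry hf hg) i j = x.2 i j := by
  simp only [snd, Matrix.of_apply]
  split_ifs
  · rfl
  · lia
  · rfl

theorem cornerDet_snd_coords_comp_toEntry (x : MatPair R a f g) :
    Matrix.cornerDet hf hg (snd (x.coords ∘ toEntry hf hg)) = Matrix.cornerDet hf hg x.2 := by
  rw [Matrix.cornerDet, Matrix.cornerDet]
  congr 1
  ext i j
  exact snd_coords_comp_toEntry_apply hf hg x (.inl i.2)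

theorem solveSnd_snd_coords_comp_toEntry (x : MatPair R a f g) :
    Matrix.solveSnd hf hg (snd (x.coords ∘ toEntry hf hg)) = Matrix.solveSnd hf hg x.2 := by
  rw [Matrix.solveSnd, Matrix.solveSnd]
  congr 1
  · congr 1
    · ext i j
      exact snd_coords_comp_toEntry_apply hf hg x (.inr j.2)
    · congr 1
      ext i j
      exact snd_coords_comp_toEntry_apply hf hg x (.inl i.2)
  · ext i j
    exact snd_coords_comp_toEntry_apply hf hg x (.inl i.2)

theorem solveFst_snd_coords_comp_toEntry (M : Matrix (Fin a) (Fin f) R) (x : MatPair R a f g) :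
    Matrix.solveFst hf hg M (snd (x.coords ∘ toEntry hf hg)) = Matrix.solveFst hf hg M x.2 := by
  rw [Matrix.solveFst, Matrix.solveFst, cornerDet_snd_coords_comp_toEntry]
  congr 3
  congr 1
  · ext i j
    exact snd_coords_comp_toEntry_apply hf hg x (.inr j.2)
  · congr 1
    ext i j
    exact snd_coords_comp_toEntry_apply hf hg x (.inl i.2)

end FreeEntries

open FreeEntries in
theorem MatPair.topologicalKrullDim_eq {k : Type*} [Field k] [IsAlgClosed k] {a f g r : ℕ}
    (hf : r ≤ f) (hg : r ≤ g) {C : Set (MatPair k a f g)}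
    (hC : IsClosed[matPairZariski k a f g] C)
    (hCi : letI : TopologicalSpace (MatPair k a f g) := matPairZariski k a f g
      IsIrreducible C)
    (hle : {x | x.1 * x.2 = 0 ∧ x.2.rank = r} ⊆ C)
    (hge : C ⊆ {x | x.1 * x.2 = 0 ∧ x.2.rank ≤ r}) :
    letI : TopologicalSpace (MatPair k a f g) := matPairZariski k a f g
    topologicalKrullDim C = (a * (f - r) + (f * r + r * (g - r)) : ℕ) := by
  let _ : TopologicalSpace (MatPair k a f g) := matPairZariski k a f g
  let M : Matrix (Fin a) (Fin f) (MvPolynomial (FreeEntries a f g r) k) := fst X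
  let L : Matrix (Fin f) (Fin g) (MvPolynomial (FreeEntries a f g r) k) := snd X
  have hX : ∀ y : FreeEntries a f g r → k, eval y ∘ X = y := fun y => by
    ext
    simp
  have hM : ∀ y, M.map (eval y) = fst y := fun y => by rw [map_fst, hX]
  have hL : ∀ y, L.map (eval y) = snd y := fun y => by rw [map_snd, hX]
  have hdet : ∀ y, eval y (Matrix.cornerDet hf hg L) = Matrix.cornerDet hf hg (snd y) := fun y => by
    rw [Matrix.map_cornerDet, hL]
  have hfst : ∀ y, (Matrix.solveFst hf hg M L).map (eval y) =
      Matrix.solveFst hf hg (fst y) (snd y) := fun y => by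
    rw [Matrix.map_solveFst, hM, hL]
  have hsnd : ∀ y, (Matrix.solveSnd hf hg L).map (eval y) =
      Matrix.solveSnd hf hg (snd y) := fun y => by
    rw [Matrix.map_solveSnd, hL]
  rw [isZariskiChart_coords.topologicalKrullDim_eq_natCard MatPair.coords_surjective hC hCi
    (toEntry hf hg) (h := Matrix.cornerDet hf hg L) ?_ ?_ ?_, natCard_eq]
  · intro h0
    let x : MatPair k a f g := (0, Matrix.of fun i j => if (i : ℕ) = j then 1 else 0)
    have h1 := hdet (x.coords ∘ toEntry hf hg)
    have h2 : x.2.submatrix (Fin.castLE hf) (Fin.castLE hg) = 1 := by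
      ext i j
      simp [x, Matrix.one_apply, Fin.ext_iff]
    rw [h0, map_zero, cornerDet_snd_coords_comp_toEntry, Matrix.cornerDet, h2, Matrix.det_one] at h1
    exact zero_ne_one h1
  · intro y hy
    rw [hdet] at hy
    refine ⟨((Matrix.cornerDet hf hg (snd y))⁻¹ • Matrix.solveFst hf hg (fst y) (snd y),
      (Matrix.cornerDet hf hg (snd y))⁻¹ • Matrix.solveSnd hf hg (snd y)), hle ⟨?_, ?_⟩, ?_⟩
    · rw [Matrix.smul_mul, Matrix.mul_smul, Matrix.solveFst_mul_solveSnd, smul_zero, smul_zero]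
    · exact Matrix.rank_smul_solveSnd hf hg hy
    · ext (⟨i, j, hj⟩ | ⟨i, j⟩ | ⟨i, j, hj⟩)
      · change (Matrix.cornerDet hf hg (snd y))⁻¹ * Matrix.solveFst hf hg (fst y) (snd y) i j = _
        rw [Matrix.solveFst_apply_of_le hf hg _ _ i hj, inv_mul_cancel_left₀ hy]
        simp [fst, hj]
      · have := congrFun₂ (Matrix.solveSnd_submatrix_columns hf hg (snd y)) i j
        change (Matrix.cornerDet hf hg (snd y))⁻¹ *
          (Matrix.solveSnd hf hg (snd y)).submatrix id (Fin.castLE hg) i j = _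
        rw [this, Matrix.smul_apply, smul_eq_mul, inv_mul_cancel_left₀ hy]
        simp [snd]
      · have := congrFun₂ (Matrix.solveSnd_submatrix_rows hf hg (snd y)) i j
        change (Matrix.cornerDet hf hg (snd y))⁻¹ *
          (Matrix.solveSnd hf hg (snd y)).submatrix (Fin.castLE hf) id i j = _
        rw [this, Matrix.smul_apply, smul_eq_mul, inv_mul_cancel_left₀ hy]
        simp [snd, hj]
  · rintro (⟨i, j⟩ | ⟨i, j⟩)
    · refine ⟨Matrix.solveFst hf hg M L i j, fun x hx hne => ?_⟩
      rw [← Matrix.map_apply (f := eval _), hfst, hdet, solveFst_snd_coords_comp_toEntry,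
        Matrix.solveFst_eq_of_mul_eq_zero hf hg (hge hx).1
          (fst_coords_comp_toEntry_apply hf hg x), cornerDet_snd_coords_comp_toEntry]
      rfl
    · refine ⟨Matrix.solveSnd hf hg L i j, fun x hx hne => ?_⟩
      rw [hdet, cornerDet_snd_coords_comp_toEntry] at hne
      rw [← Matrix.map_apply (f := eval _), hsnd, hdet, solveSnd_snd_coords_comp_toEntry,
        Matrix.solveSnd_eq_of_rank_le hf hg hne (hge hx).2, cornerDet_snd_coords_comp_toEntry]
      rfl

end Dimension

section Components

variable {k : Type*} [Field k] {a f g : ℕ}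

theorem Matrix.rank_add_rank_le_of_mul_eq_zero {M : Matrix (Fin a) (Fin f) k}
    {L : Matrix (Fin f) (Fin g) k} (h : M * L = 0) : M.rank + L.rank ≤ f := by
  simpa using Matrix.rank_add_rank_le_card_of_mul_eq_zero h

theorem Matrix.exists_rank_eq_width (hgf : g ≤ f) :
    ∃ L : Matrix (Fin f) (Fin g) k, L.rank = g := by
  refine ⟨(1 : Matrix (Fin f) (Fin f) k).submatrix id (Fin.castLE hgf),
    Matrix.rank_eq_width_iff_exists_det_mul_ne_zero.2
      ⟨(1 : Matrix (Fin f) (Fin f) k).submatrix (Fin.castLE hgf) id, ?_⟩⟩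
  have : (1 : Matrix (Fin f) (Fin f) k).submatrix (Fin.castLE hgf) id *
      (1 : Matrix (Fin f) (Fin f) k).submatrix id (Fin.castLE hgf) = 1 := by
    rw [← Matrix.submatrix_mul _ _ _ _ _ Function.bijective_id, Matrix.one_mul,
      Matrix.submatrix_one _ (Fin.castLE_injective hgf)]
  simp [this]

theorem Matrix.exists_det_submatrix_castLE_ne_zero {m : ℕ} (hma : m ≤ a) (hmf : m ≤ f) :
    ∃ M : Matrix (Fin a) (Fin f) k,
      (M.submatrix (Fin.castLE hma) (Fin.castLE hmf)).det ≠ 0 := by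
  refine ⟨Matrix.of fun i j => if (i : ℕ) = j then 1 else 0, ?_⟩
  have : (Matrix.of fun (i : Fin a) (j : Fin f) => if (i : ℕ) = j then (1 : k) else 0).submatrix
      (Fin.castLE hma) (Fin.castLE hmf) = 1 := by
    ext i j
    simp [Matrix.one_apply, Fin.ext_iff]
  simp [this]

theorem Matrix.rank_lt_width_of_det_submatrix_ne_zero {M : Matrix (Fin a) (Fin f) k}
    {L : Matrix (Fin f) (Fin g) k} (hML : M * L = 0) {m : ℕ} (hm : f < m + g)
    {u : Fin m → Fin a} {v : Fin m → Fin f} (hM : (M.submatrix u v).det ≠ 0) : L.rank < g := by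
  have h := Matrix.rank_of_isUnit _ ((Matrix.isUnit_iff_isUnit_det _).2 (isUnit_iff_ne_zero.2 hM))
  rw [Fintype.card_fin] at h
  have h1 := Matrix.rank_submatrix_le M u v
  have h2 := Matrix.rank_add_rank_le_of_mul_eq_zero hML
  lia

theorem MatPair.isIrreducible_rank_eq_width [Infinite k] (hgf : g ≤ f) :
    letI : TopologicalSpace (MatPair k a f g) := matPairZariski k a f g
    IsIrreducible {x : MatPair k a f g | x.1 * x.2 = 0 ∧ x.2.rank = g} := by
  let _ : TopologicalSpace (MatPair k a f g) := matPairZariski k a f g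
  have heq : {x : MatPair k a f g | x.1 * x.2 = 0 ∧ x.2.rank = g} =
      MatPair.stratum k a f g g ∩ {x : MatPair k a f g | x.2.rank = g} := by
    ext x
    constructor
    · rintro ⟨h, hr⟩
      have := Matrix.rank_add_rank_le_of_mul_eq_zero h
      exact ⟨⟨h, hr.le, by lia⟩, hr⟩
    · rintro ⟨⟨h, -, -⟩, hr⟩
      exact ⟨h, hr⟩
  rw [heq]
  refine ⟨?_, ?_⟩
  · obtain ⟨L, hL⟩ := Matrix.exists_rank_eq_width (k := k) hgf
    exact ⟨(0, L), ⟨by simp, hL.le, by simpa using hgf⟩, hL⟩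
  · intro u v hu hv hxu hxv
    obtain ⟨x, ⟨hx, hxr⟩, hxu⟩ := hxu
    obtain ⟨y, ⟨hy, hyr⟩, hyv⟩ := hxv
    obtain ⟨z, hz, ⟨hzr, hzu⟩, -, hzv⟩ := (MatPair.isIrreducible_stratum hgf).2 _ _
      (MatPair.isOpen_rank_snd_eq.inter hu) (MatPair.isOpen_rank_snd_eq.inter hv)
      ⟨x, hx, hxr, hxu⟩ ⟨y, hy, hyr, hyv⟩
    exact ⟨z, ⟨hz, hzr⟩, hzu, hzv⟩

end Components

/-- Let `k` be an algebraically closed field, `f ≥ g ≥ 1`, `a ≥ 1`, and let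
`Z = {(M, L) : M·L = 0}` with its Zariski topology.  If `a > f − g` then `Z` is not
irreducible.  Moreover if `a = f − g + 1` then `Z` has exactly two irreducible
components, namely the closure `C₁` of `{(M, L) ∈ Z : rank L = g}` and the closed set
`C₂ = {(M, L) ∈ Z : rank L ≤ g − 1}`, and both components have (topological Krull)
dimension `fg + a(f − g)`. -/
theorem varietyOfComplexes_reducible_two_components
    (k : Type*) [Field k] [IsAlgClosed k] (a f g : ℕ)
    (hg : 1 ≤ g) (hgf : g ≤ f) (ha : 1 ≤ a) :
    letI : TopologicalSpace (MatPair k a f g) := matPairZariski k a f g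
    let Z : Set (MatPair k a f g) := {x | x.1 * x.2 = 0}
    (f - g < a → ¬ IsIrreducible Z) ∧
    (a = f - g + 1 →
      let C₁ : Set (MatPair k a f g) := closure {x | x.1 * x.2 = 0 ∧ x.2.rank = g}
      let C₂ : Set (MatPair k a f g) := {x | x.1 * x.2 = 0 ∧ x.2.rank ≤ g - 1}
      Z = C₁ ∪ C₂ ∧
      IsClosed C₁ ∧ IsClosed C₂ ∧
      IsIrreducible C₁ ∧ IsIrreducible C₂ ∧
      ¬ C₁ ⊆ C₂ ∧ ¬ C₂ ⊆ C₁ ∧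
      (∀ C : Set (MatPair k a f g), C ⊆ Z → IsIrreducible C → C ⊆ C₁ ∨ C ⊆ C₂) ∧
      topologicalKrullDim C₁ = ((f * g + a * (f - g) : ℕ) : WithBot ℕ∞) ∧
      topologicalKrullDim C₂ = ((f * g + a * (f - g) : ℕ) : WithBot ℕ∞)) := by
  let _ : TopologicalSpace (MatPair k a f g) := matPairZariski k a f g
  have : Infinite k := IsAlgClosed.instInfinite
  intro Z
  obtain ⟨L₀, hL₀⟩ := Matrix.exists_rank_eq_width (k := k) hgf
  refine ⟨fun haf hZ => ?_, fun haf => ?_⟩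
  · have hma : f - g + 1 ≤ a := haf
    have hmf : f - g + 1 ≤ f := by lia
    obtain ⟨M₀, hM₀⟩ := Matrix.exists_det_submatrix_castLE_ne_zero (k := k) hma hmf
    obtain ⟨x, hxZ, hxL, hxM⟩ := hZ.2 _ _ MatPair.isOpen_rank_snd_eq
      (MatPair.isOpen_det_submatrix_fst_ne_zero (Fin.castLE hma) (Fin.castLE hmf))
      ⟨(0, L₀), Matrix.zero_mul _, hL₀⟩ ⟨(M₀, 0), Matrix.mul_zero _, hM₀⟩
    exact (Matrix.rank_lt_width_of_det_submatrix_ne_zero hxZ (by lia) hxM).ne hxL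
  intro C₁ C₂
  have hZ : IsClosed Z := MatPair.isClosed_mul_eq_zero
  have hC₁Z : C₁ ⊆ Z := closure_minimal (fun x hx => hx.1) hZ
  have hC₂ : IsClosed C₂ := by
    have : C₂ = Z ∩ {x : MatPair k a f g | x.2.rank = g}ᶜ := by
      ext x
      have := Matrix.rank_le_width x.2
      refine and_congr_right fun _ => ?_
      simp only [Set.mem_compl_iff, Set.mem_ofPred_eq]
      lia
    rw [this]
    exact hZ.inter MatPair.isOpen_rank_snd_eq.isClosed_compl
  have hunion : Z = C₁ ∪ C₂ := by
    refine Set.Subset.antisymm (fun x hx => ?_) (Set.union_subset hC₁Z fun x hx => hx.1)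
    have := Matrix.rank_le_width x.2
    rcases this.eq_or_lt with h | h
    · exact .inl (subset_closure ⟨hx, h⟩)
    · exact .inr ⟨hx, Nat.le_sub_one_of_lt h⟩
  have hC₁i : IsIrreducible C₁ := (MatPair.isIrreducible_rank_eq_width hgf).closure
  have hC₂i : IsIrreducible C₂ := by
    have : C₂ = MatPair.stratum k a f g (g - 1) := by
      ext x
      refine and_congr_right fun _ => (and_iff_left ?_).symm
      have := Matrix.rank_le_height x.1
      lia
    rw [this]
    exact MatPair.isIrreducible_stratum (by lia)
  refine ⟨hunion, isClosed_closure, hC₂, hC₁i, hC₂i, fun h => ?_, fun h => ?_,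
    fun C hCZ hC => ?_, ?_, ?_⟩
  · have := (h (subset_closure ⟨Matrix.zero_mul L₀, hL₀⟩ : ((0, L₀) : MatPair k a f g) ∈ C₁)).2
    change L₀.rank ≤ g - 1 at this
    lia
  · have hma : f - g + 1 ≤ a := haf.ge
    have hmf : f - g + 1 ≤ f := by lia
    obtain ⟨M₀, hM₀⟩ := Matrix.exists_det_submatrix_castLE_ne_zero (k := k) hma hmf
    have hmem : ((M₀, 0) : MatPair k a f g) ∈ C₂ := ⟨Matrix.mul_zero _, by simp⟩
    obtain ⟨x, hxM, hxZ, hxL⟩ := mem_closure_iff.1 (h hmem) _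
      (MatPair.isOpen_det_submatrix_fst_ne_zero (Fin.castLE hma) (Fin.castLE hmf)) hM₀
    exact (Matrix.rank_lt_width_of_det_submatrix_ne_zero hxZ (by lia) hxM).ne hxL
  · exact isPreirreducible_iff_isClosed_union_isClosed.1 hC.2 _ _ isClosed_closure hC₂
      (hunion ▸ hCZ)
  · rw [MatPair.topologicalKrullDim_eq hgf le_rfl isClosed_closure hC₁i subset_closure
      fun x hx => ⟨hC₁Z hx, x.2.rank_le_width⟩]
    refine congrArg (Nat.cast : ℕ → WithBot ℕ∞) ?_
    rw [Nat.sub_self]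
    ring
  · rw [MatPair.topologicalKrullDim_eq (r := g - 1) (by lia) (by lia) hC₂ hC₂i
      (fun x hx => ⟨hx.1, hx.2.le⟩) fun x hx => hx]
    refine congrArg (Nat.cast : ℕ → WithBot ℕ∞) ?_
    obtain ⟨g, rfl⟩ := Nat.exists_eq_add_of_le' hg
    obtain ⟨d, rfl⟩ := Nat.exists_eq_add_of_le' hgf
    have h1 : d + (g + 1) - (g + 1 - 1) = d + 1 := by lia
    have h2 : d + (g + 1) - (g + 1) = d := by lia
    rw [h2] at haf
    have h3 : g + 1 - (g + 1 - 1) = 1 := by lia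
    rw [h1, h2, h3, haf, Nat.add_sub_cancel]
    ring
end
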